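/- For every δ ∈ (0,1] there exists τ₀ > 0 such that for all τ, ν with 0 < ν ≤ τ ≤ τ₀ there exists n₀ ∈ ℕ such that the following holds for every even n ≥ n₀, with ℓ := ⌈(log n)²⌉ + 1: let G be a robust (ν,τ)-expander on n vertices in which every vertex has degree exactly δn, let N be a matching in G, and let k be an integer with 1 ≤ k ≤ min{|N|, n^{1/3}}. Then for every perfect matching M' of G containing exactly k−1 edges of N, the number of perfect matchings M of G containing exactly k edges of N such that the symmetric difference M △ M' is a cycle of length 2ℓ whose edge set meets N in exactly one edge is between (1 − 3n^{−1/6})·δ^{ℓ−1}·n^{ℓ−2}·(|N|−k+1) and (1 + 3n^{−1/6})·δ^{ℓ−1}·n^{ℓ−2}·(|N|−k+1). -/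

import Mathlib

open Finset

namespace RPM

/-- The `ν`-robust neighbourhood of a vertex set `S` in a graph `G` on `n` vertices:
all vertices having at least `ν * n` neighbours in `S`. -/
def RN {V : Type*} [Fintype V] (G : SimpleGraph V) (ν : ℝ) (S : Set V) : Set V :=
  {v : V | ν * (Fintype.card V : ℝ) ≤ (Nat.card {u : V | u ∈ S ∧ G.Adj v u} : ℝ)}

/-- `G` is a robust `(ν, τ)`-expander. -/
def RobustExpander {V : Type*} [Fintype V] (G : SimpleGraph V) (ν τ : ℝ) : Prop :=
  ∀ S : Set V,
    τ * (Fintype.card V : ℝ) ≤ (Nat.card S : ℝ) →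
    (Nat.card S : ℝ) ≤ (1 - τ) * (Fintype.card V : ℝ) →
    (Nat.card S : ℝ) + ν * (Fintype.card V : ℝ) ≤ (Nat.card (RN G ν S) : ℝ)

/-- `M` (a set of edges) is a perfect matching of `G`: its edges are edges of `G`,
and every vertex lies in exactly one edge of `M` (in particular the edges are
pairwise disjoint and cover all vertices). -/
def IsPM {V : Type*} (G : SimpleGraph V) (M : Finset (Sym2 V)) : Prop :=
  (∀ e ∈ M, e ∈ G.edgeSet) ∧ ∀ v : V, ∃! e, e ∈ M ∧ v ∈ e

/-- The number of perfect matchings of `G`. -/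
noncomputable def pmCount {V : Type*} (G : SimpleGraph V) : ℕ :=
  Nat.card {M : Finset (Sym2 V) // IsPM G M}

/-- `N` (a set of edges) is a matching in `G`: edges of `G`, pairwise disjoint. -/
def IsMatchingIn {V : Type*} (G : SimpleGraph V) (N : Finset (Sym2 V)) : Prop :=
  (∀ e ∈ N, e ∈ G.edgeSet) ∧ ∀ e ∈ N, ∀ f ∈ N, e ≠ f → ∀ v : V, v ∈ e → v ∉ f

/-- `G` is `d`-regular: every vertex has exactly `d` neighbours. -/
def RegularDeg {V : Type*} (G : SimpleGraph V) (d : ℕ) : Prop :=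
  ∀ v : V, Nat.card {u : V | G.Adj v u} = d

/-- Probability that a uniformly random perfect matching of `G` contains the edge `e`. -/
noncomputable def edgeProb {V : Type*} (G : SimpleGraph V) (e : Sym2 V) : ℝ :=
  (Nat.card {M : Finset (Sym2 V) // IsPM G M ∧ e ∈ M} : ℝ) / (pmCount G : ℝ)

/-- `P[X = k]` where `X = |M ∩ N|` for a uniformly random perfect matching `M` of `G`. -/
noncomputable def interProb {V : Type*} [DecidableEq V] (G : SimpleGraph V)
    (N : Finset (Sym2 V)) (k : ℕ) : ℝ :=
  (Nat.card {M : Finset (Sym2 V) // IsPM G M ∧ (M ∩ N).card = k} : ℝ) / (pmCount G : ℝ)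

/-- The Poisson probability mass function with parameter `lam`. -/
noncomputable def poissonPMF (lam : ℝ) (k : ℕ) : ℝ :=
  Real.exp (-lam) * lam ^ k / (Nat.factorial k)

/-- The edge set `E` forms a cycle of length `m`: there is an injective cyclic sequence
of `m` vertices whose `m` consecutive (distinct) pairs are exactly the edges of `E`. -/
def IsCycleEdgeSet {V : Type*} [DecidableEq V] (E : Finset (Sym2 V)) (m : ℕ) : Prop :=
  ∃ c : Fin m → V, Function.Injective c ∧
    E = Finset.image (fun i : Fin m => s(c i, c (finRotate m i))) Finset.univ ∧ E.card = m

/-- The matrix of the walk which from `u` first follows `σ` and then an edge of `G`. -/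
def walkMatrix {V : Type*} (G : SimpleGraph V) [DecidableRel G.Adj] (σ : V → V) :
    Matrix V V ℝ :=
  Matrix.of fun u w => if G.Adj (σ u) w then 1 else 0

lemma walkMatrix_nonneg {V : Type*} (G : SimpleGraph V) [DecidableRel G.Adj] (σ : V → V)
    (u w : V) : 0 ≤ walkMatrix G σ u w := by
  simp only [walkMatrix, Matrix.of_apply]
  split_ifs <;> norm_num

lemma mem_RN {V : Type*} [Fintype V] (G : SimpleGraph V) [DecidableRel G.Adj] (ν : ℝ)
    (S : Finset V) (v : V) :
    v ∈ RN G ν S ↔ ν * Fintype.card V ≤ (#{u ∈ S | G.Adj v u} : ℝ) := by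
  have h : Nat.card {u : V | u ∈ (S : Set V) ∧ G.Adj v u} = #{u ∈ S | G.Adj v u} := by
    rw [Nat.card_eq_card_toFinset]
    congr 1
    ext; simp
  rw [← h]
  rfl

/-- All entries of the column `z` of `Q` lie in an interval of length at most `c`. -/
def ColOscLE {V : Type*} (Q : Matrix V V ℝ) (z : V) (c : ℝ) : Prop :=
  ∃ a b : ℝ, b - a ≤ c ∧ ∀ u, a ≤ Q u z ∧ Q u z ≤ b

lemma colOscLE_one {V : Type*} [DecidableEq V] (z : V) : ColOscLE (1 : Matrix V V ℝ) z 1 := by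
  refine ⟨0, 1, by norm_num, fun u => ?_⟩
  rw [Matrix.one_apply]
  split_ifs <;> norm_num

section Mixing

variable {V : Type*} [Fintype V]

lemma card_le_of_row_sum (P : Matrix V V ℝ) {h D : ℝ} (hP : ∀ u w, h ≤ P u w)
    (hD : ∀ u, ∑ w, P u w = D) (u : V) : (Fintype.card V : ℝ) * h ≤ D := by
  rw [← hD u, ← nsmul_eq_mul, ← Finset.card_univ]
  exact Finset.card_nsmul_le_sum _ _ _ fun w _ => hP u w

lemma row_mul_mem_interval (P : Matrix V V ℝ) {h D a b : ℝ} {f : V → ℝ}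
    (hP : ∀ u w, h ≤ P u w) (hD : ∀ u, ∑ w, P u w = D)
    (hf : ∀ w, a ≤ f w ∧ f w ≤ b) (u : V) :
    (D - Fintype.card V * h) * a + h * ∑ w, f w ≤ ∑ w, P u w * f w ∧
      ∑ w, P u w * f w ≤ (D - Fintype.card V * h) * b + h * ∑ w, f w := by
  have key : ∀ x : ℝ, (D - Fintype.card V * h) * x + h * ∑ w, f w
      = ∑ w, ((P u w - h) * x + h * f w) := by
    intro x
    rw [Finset.sum_add_distrib, ← Finset.sum_mul, Finset.sum_sub_distrib, hD, Finset.mul_sum]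
    simp
  constructor
  · rw [key]
    refine Finset.sum_le_sum fun w _ => ?_
    nlinarith [mul_le_mul_of_nonneg_left (hf w).1 (sub_nonneg.2 (hP u w))]
  · rw [key]
    refine Finset.sum_le_sum fun w _ => ?_
    nlinarith [mul_le_mul_of_nonneg_left (hf w).2 (sub_nonneg.2 (hP u w))]

lemma ColOscLE.mul {P Q : Matrix V V ℝ} {z : V} {c h D : ℝ} (hQ : ColOscLE Q z c)
    (hP : ∀ u w, h ≤ P u w) (hD : ∀ u, ∑ w, P u w = D) :
    ColOscLE (P * Q) z ((D - Fintype.card V * h) * c) := by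
  obtain ⟨a, b, hab, hf⟩ := hQ
  refine ⟨_, _, ?_, fun u => row_mul_mem_interval P hP hD hf u⟩
  have := card_le_of_row_sum P hP hD z
  nlinarith [mul_le_mul_of_nonneg_left hab (sub_nonneg.2 this)]

lemma ColOscLE.abs_sub_le {Q : Matrix V V ℝ} {z : V} {c : ℝ} (hQ : ColOscLE Q z c) (u : V) :
    |Q u z - (∑ w, Q w z) / Fintype.card V| ≤ c := by
  obtain ⟨a, b, hab, hf⟩ := hQ
  have hn : (0 : ℝ) < Fintype.card V := by exact_mod_cast Fintype.card_pos_iff.2 ⟨z⟩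
  have h1 : a ≤ (∑ w, Q w z) / Fintype.card V := by
    rw [le_div_iff₀ hn, mul_comm, ← nsmul_eq_mul, ← Finset.card_univ]
    exact Finset.card_nsmul_le_sum _ _ _ fun w _ => (hf w).1
  have h2 : (∑ w, Q w z) / Fintype.card V ≤ b := by
    rw [div_le_iff₀ hn, mul_comm, ← nsmul_eq_mul, ← Finset.card_univ]
    exact Finset.sum_le_card_nsmul _ _ _ fun w _ => (hf w).2
  rw [abs_le]
  constructor <;> linarith [hf u]

variable (G : SimpleGraph V) [DecidableRel G.Adj] (σ : V → V)

lemma walkMatrix_row_sum {d : ℕ} (hd : ∀ v, G.degree v = d) (u : V) :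
    ∑ w, walkMatrix G σ u w = d := by
  simp [walkMatrix, ← hd (σ u), ← SimpleGraph.card_neighborFinset_eq_degree,
    SimpleGraph.neighborFinset_eq_filter]

lemma walkMatrix_col_sum {d : ℕ} (hd : ∀ v, G.degree v = d) (hσ : Function.Involutive σ)
    (w : V) : ∑ u, walkMatrix G σ u w = d := by
  rw [← Equiv.sum_comp hσ.toPerm]
  simp [walkMatrix, ← hd w, ← SimpleGraph.card_neighborFinset_eq_degree,
    SimpleGraph.neighborFinset_eq_filter, hσ _, G.adj_comm]

variable [DecidableEq V]

lemma ColOscLE.pow_mul {P Q : Matrix V V ℝ} {z : V} {c h D : ℝ} (hQ : ColOscLE Q z c)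
    (hP : ∀ u w, h ≤ P u w) (hD : ∀ u, ∑ w, P u w = D) (q : ℕ) :
    ColOscLE (P ^ q * Q) z ((D - Fintype.card V * h) ^ q * c) := by
  induction q with
  | zero => simpa using hQ
  | succ q ih =>
    rw [pow_succ', pow_succ', mul_assoc, mul_assoc]
    exact ih.mul hP hD

lemma row_sum_pow (B : Matrix V V ℝ) {D : ℝ} (hD : ∀ u, ∑ w, B u w = D) (m : ℕ) (u : V) :
    ∑ w, (B ^ m) u w = D ^ m := by
  have h : ∀ m, (B ^ m).mulVec 1 = fun _ => D ^ m := by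
    intro m
    induction m with
    | zero => ext; simp
    | succ m ih =>
      rw [pow_succ', ← Matrix.mulVec_mulVec, ih]
      ext u
      simp only [Matrix.mulVec, dotProduct]
      rw [← Finset.sum_mul, hD, pow_succ']
  simpa [Matrix.mulVec, dotProduct] using congrFun (h m) u

lemma col_sum_pow (B : Matrix V V ℝ) {D : ℝ} (hD : ∀ w, ∑ u, B u w = D) (m : ℕ) (w : V) :
    ∑ u, (B ^ m) u w = D ^ m := by
  have := row_sum_pow B.transpose (fun u => by simpa using hD u) m w
  simpa [← Matrix.transpose_pow] using this

lemma pow_nonneg_entries (B : Matrix V V ℝ) (hB : ∀ u w, 0 ≤ B u w) (m : ℕ) (u w : V) :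
    0 ≤ (B ^ m) u w := by
  induction m generalizing u with
  | zero => rw [pow_zero, Matrix.one_apply]; split_ifs <;> norm_num
  | succ m ih =>
    rw [pow_succ', Matrix.mul_apply]
    exact Finset.sum_nonneg fun v _ => mul_nonneg (hB _ _) (ih _)

lemma exists_large_pow_walkMatrix {d : ℕ} (hd : ∀ v, G.degree v = d)
    (hσ : Function.Involutive σ) {ν τ : ℝ} (hν : 0 < ν) (hντ : ν ≤ τ)
    (hτ : 2 * τ * Fintype.card V ≤ d) (hG : RobustExpander G ν τ) (z : V) (t : ℕ) :
    ∃ S : Finset V, min (Fintype.card V : ℝ) (d + t * (ν * Fintype.card V)) ≤ #S ∧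
      ∀ v ∈ S, (ν * Fintype.card V) ^ t ≤ (walkMatrix G σ ^ (t + 1)) v z := by
  have hn : (0 : ℝ) ≤ Fintype.card V := by positivity
  have hνn : 0 ≤ ν * Fintype.card V := by positivity
  induction t with
  | zero =>
    refine ⟨({v | G.Adj (σ v) z} : Finset V), ?_,
        fun v hv => ?_⟩
    · refine (min_le_right _ _).trans ?_
      rw [← walkMatrix_col_sum G σ hd hσ z]
      simp [walkMatrix]
    · simp only [mem_filter, mem_univ, true_and] at hv
      simp [walkMatrix, hv]
  | succ t ih =>
    obtain ⟨S, hS, hpow⟩ := ih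
    have hstep : ∀ v, ν * Fintype.card V ≤ #{u ∈ S | G.Adj (σ v) u} →
        (ν * Fintype.card V) ^ (t + 1) ≤ (walkMatrix G σ ^ (t + 1 + 1)) v z := by
      intro v hv
      rw [pow_succ', pow_succ', Matrix.mul_apply]
      calc ν * Fintype.card V * (ν * Fintype.card V) ^ t
          ≤ #{u ∈ S | G.Adj (σ v) u} * (ν * Fintype.card V) ^ t := by gcongr
        _ = ∑ u ∈ S with G.Adj (σ v) u, (ν * Fintype.card V) ^ t := by simp
        _ ≤ ∑ u ∈ S with G.Adj (σ v) u,
              walkMatrix G σ v u * (walkMatrix G σ ^ (t + 1)) u z := by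
            refine Finset.sum_le_sum fun u hu => ?_
            rw [mem_filter] at hu
            simpa [walkMatrix, hu.2] using hpow u hu.1
        _ ≤ _ := Finset.sum_le_sum_of_subset_of_nonneg (subset_univ _) fun u _ _ =>
            mul_nonneg (walkMatrix_nonneg ..)
              (pow_nonneg_entries _ (walkMatrix_nonneg G σ) _ _ _)
    by_cases hbig : (#S : ℝ) ≤ (1 - τ) * Fintype.card V
    · have hdn : (d : ℝ) ≤ Fintype.card V := by
        exact_mod_cast hd z ▸ (G.degree_lt_card_verts z).le
      have hS' : τ * Fintype.card V ≤ #S := by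
        refine le_trans ?_ hS
        have : 0 ≤ t * (ν * Fintype.card V) := by positivity
        have : 0 ≤ τ * Fintype.card V := by have := hν.trans_le hντ; positivity
        exact le_min (by linarith) (by linarith)
      have hexp := hG (S : Set V) (by simpa using hS') (by simpa using hbig)
      refine ⟨({v | ν * Fintype.card V ≤ (#{u ∈ S | G.Adj (σ v) u} : ℝ)} : Finset V), ?_,
        fun v hv => ?_⟩
      · have hcard : Nat.card (RN G ν (S : Set V))
            = #{v | ν * Fintype.card V ≤ (#{u ∈ S | G.Adj (σ v) u} : ℝ)} := by
          classical
          rw [Nat.card_eq_card_toFinset, ← Finset.card_map hσ.toPerm.toEmbedding]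
          congr 1
          ext v
          simp only [mem_map_equiv, Set.mem_toFinset, mem_RN, mem_filter, mem_univ, true_and]
          rw [Function.Involutive.toPerm_symm, Function.Involutive.coe_toPerm]
        rw [hcard] at hexp
        refine le_trans ?_ hexp
        simp only [Nat.card_coe_set_eq, Set.ncard_coe_finset]
        rcases min_le_iff.1 hS with h | h
        · exact (min_le_left _ _).trans (by linarith)
        · refine (min_le_right _ _).trans ?_
          push_cast
          linarith
      · exact hstep v (by simpa using hv)
    · refine ⟨univ, by simp, fun v _ => hstep v ?_⟩
      have h1 : (d : ℝ) ≤ #{u ∈ S | G.Adj (σ v) u} + #Sᶜ := by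
        rw [← hd (σ v), ← SimpleGraph.card_neighborFinset_eq_degree]
        norm_cast
        refine (Finset.card_le_card (t := {u ∈ S | G.Adj (σ v) u} ∪ Sᶜ) fun u hu => ?_).trans
          (Finset.card_union_le _ _)
        simp only [SimpleGraph.mem_neighborFinset] at hu
        simp only [mem_union, mem_filter, mem_compl, hu, and_true]
        exact em _
      have h2 : (#S : ℝ) + #Sᶜ = Fintype.card V := by exact_mod_cast Finset.card_add_card_compl S
      nlinarith

lemma abs_pow_walkMatrix_sub_le {d : ℕ} (hd : ∀ v, G.degree v = d)
    (hσ : Function.Involutive σ) {ν τ : ℝ} (hν : 0 < ν) (hντ : ν ≤ τ)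
    (hτ : 2 * τ * Fintype.card V ≤ d) (hG : RobustExpander G ν τ) {t : ℕ} (ht : 1 ≤ t * ν)
    (L : ℕ) (y z : V) :
    |(walkMatrix G σ ^ L) y z - (d : ℝ) ^ L / Fintype.card V|
      ≤ (d : ℝ) ^ L * (1 - ν ^ t) ^ (L / (t + 1)) := by
  set B := walkMatrix G σ with hB
  set n : ℝ := (Fintype.card V : ℝ) with hn
  have hn0 : 0 < n := by rw [hn]; exact_mod_cast Fintype.card_pos_iff.2 ⟨z⟩
  have hdn : (d : ℝ) ≤ n := by
    rw [hn]; exact_mod_cast hd z ▸ (G.degree_lt_card_verts z).le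
  have hrow := row_sum_pow B (walkMatrix_row_sum G σ hd)
  have hcol := col_sum_pow B (walkMatrix_col_sum G σ hd hσ)
  have hlow : ∀ u w, (ν * n) ^ t ≤ (B ^ (t + 1)) u w := by
    intro u w
    obtain ⟨S, hS, h⟩ := exists_large_pow_walkMatrix G σ hd hσ hν hντ hτ hG w t
    refine h u ?_
    have hSn : n ≤ #S := by
      refine le_trans (le_min le_rfl ?_) hS
      have : (0 : ℝ) ≤ d := by positivity
      rw [← hn]
      nlinarith
    have : S = univ := by
      rw [← Finset.card_eq_iff_eq_univ]
      exact le_antisymm (card_le_univ S) (by rw [hn] at hSn; exact_mod_cast hSn)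
    rw [this]; exact mem_univ _
  have h1 := ((colOscLE_one z).pow_mul hlow (hrow (t + 1)) (L / (t + 1))).mul
    (pow_nonneg_entries B (walkMatrix_nonneg G σ) (L % (t + 1))) (hrow _)
  rw [mul_one, ← pow_mul, ← pow_add, Nat.mod_add_div] at h1
  refine le_trans (hcol L z ▸ h1.abs_sub_le y) ?_
  have hd0 : (0 : ℝ) ≤ d := by positivity
  have hc : (d : ℝ) ^ (t + 1) - n * (ν * n) ^ t ≤ d ^ (t + 1) * (1 - ν ^ t) := by
    have : (d : ℝ) ^ (t + 1) * ν ^ t ≤ n ^ (t + 1) * ν ^ t := by gcongr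
    rw [mul_pow]
    linarith [this, pow_succ' n t, mul_comm (n ^ (t + 1)) (ν ^ t),
      show n * (ν ^ t * n ^ t) = n ^ (t + 1) * ν ^ t by ring]
  have hc0 : 0 ≤ (d : ℝ) ^ (t + 1) - n * (ν * n) ^ t :=
    sub_nonneg.2 (card_le_of_row_sum _ hlow (hrow _) z)
  calc ((d : ℝ) ^ (L % (t + 1)) - n * 0) *
        (((d : ℝ) ^ (t + 1) - n * (ν * n) ^ t) ^ (L / (t + 1)) * 1)
      ≤ (d : ℝ) ^ (L % (t + 1)) * (d ^ (t + 1) * (1 - ν ^ t)) ^ (L / (t + 1)) := by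
        rw [mul_zero, sub_zero, mul_one]
        gcongr
    _ = (d : ℝ) ^ L * (1 - ν ^ t) ^ (L / (t + 1)) := by
        rw [mul_pow, ← mul_assoc, ← pow_mul, ← pow_add, Nat.mod_add_div]

end Mixing

/-- Lists in which every entry but the last avoids the set which `X` assigns to its tail. -/
inductive Avoiding {V : Type*} (X : List V → Finset V) : List V → Prop
  | single (y : V) : Avoiding X [y]
  | cons {v : V} {l : List V} (hv : v ∉ X l) (hl : Avoiding X l) : Avoiding X (v :: l)

section Walks

variable {V : Type*} [Fintype V] [DecidableEq V] (G : SimpleGraph V) [DecidableRel G.Adj]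
  (σ : V → V)

/-- The walks with `m` steps starting from `y`, as lists whose head is the latest vertex. -/
def walks (y : V) : ℕ → Finset (List V)
  | 0 => {[y]}
  | m + 1 => (walks y m).biUnion fun l => (G.neighborFinset (σ (l.headD y))).image (· :: l)

lemma mem_walks_succ {y : V} {m : ℕ} {l : List V} : l ∈ walks G σ y (m + 1) ↔
    ∃ v l', l = v :: l' ∧ l' ∈ walks G σ y m ∧ G.Adj (σ (l'.headD y)) v := by
  simp only [walks, mem_biUnion, mem_image, SimpleGraph.mem_neighborFinset]
  constructor
  · rintro ⟨l', hl', v, hv, rfl⟩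
    exact ⟨v, l', rfl, hl', hv⟩
  · rintro ⟨v, l', rfl, hl', hv⟩
    exact ⟨l', hl', v, hv, rfl⟩

lemma mem_walks_iff {y : V} {m : ℕ} {l : List V} : l ∈ walks G σ y m ↔
    l.length = m + 1 ∧ l.getLast? = some y ∧ l.IsChain fun v u => G.Adj (σ u) v := by
  induction m generalizing l with
  | zero =>
    simp only [walks, mem_singleton, zero_add, List.length_eq_one_iff]
    constructor
    · rintro rfl; simp
    · rintro ⟨⟨a, rfl⟩, h, -⟩; simpa using h
  | succ m ih =>
    simp only [mem_walks_succ, ih]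
    constructor
    · rintro ⟨v, l', rfl, ⟨h1, h2, h3⟩, h4⟩
      cases l' with
      | nil => simp at h1
      | cons u l' => simp_all
    · rintro ⟨h1, h2, h3⟩
      match l, h1, h2, h3 with
      | v :: u :: l', h1, h2, h3 =>
        exact ⟨v, u :: l', rfl, by simp_all⟩

lemma sum_walks (y : V) (m : ℕ) (f : V → ℝ) :
    ∑ l ∈ walks G σ y m, f (l.headD y) = ((walkMatrix G σ ^ m).mulVec f) y := by
  induction m generalizing f with
  | zero => simp [walks]
  | succ m ih =>
    rw [walks, Finset.sum_biUnion]
    · simp only [implies_true, Set.injOn_of_eq_iff_eq,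
        Finset.sum_image, List.cons.injEq, and_true, List.headD_cons]
      rw [pow_succ, ← Matrix.mulVec_mulVec, ← ih]
      refine Finset.sum_congr rfl fun l _ => ?_
      simp [Matrix.mulVec, dotProduct, walkMatrix, SimpleGraph.neighborFinset_eq_filter,
        Finset.sum_filter]
    · intro l _ l' _ hne
      simp only [Function.onFun, Finset.disjoint_left, mem_image]
      rintro _ ⟨v, -, rfl⟩ ⟨w, -, h⟩
      exact hne (List.cons.inj h).2.symm

lemma card_walks_headD_eq (y z : V) (m : ℕ) :
    (#{l ∈ walks G σ y m | l.headD y = z} : ℝ) = (walkMatrix G σ ^ m) y z := by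
  have := sum_walks G σ y m fun v => if v = z then 1 else 0
  simpa [Matrix.mulVec, dotProduct] using this

lemma card_walks_le {d : ℕ} (hd : ∀ v, G.degree v = d) (y : V) (m : ℕ) :
    #(walks G σ y m) ≤ d ^ m := by
  induction m with
  | zero => simp [walks]
  | succ m ih =>
    rw [walks, pow_succ]
    refine (Finset.card_biUnion_le_card_mul _ _ d fun l _ => ?_).trans
      (Nat.mul_le_mul_right d ih)
    exact Finset.card_image_le.trans (by simp [hd])

open Classical in
lemma card_not_avoiding_mul_le {d : ℕ} (hd : ∀ v, G.degree v = d) (y : V)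
    (X : List V → Finset V) (K m : ℕ) (hX : ∀ l : List V, l.length ≤ m → #(X l) ≤ K) :
    #{l ∈ walks G σ y m | ¬ Avoiding X l} * d ≤ m * K * d ^ m := by
  induction m with
  | zero =>
    have : {l ∈ walks G σ y 0 | ¬ Avoiding X l} = ∅ := by
      simp [walks, Finset.filter_eq_empty_iff, Avoiding.single y]
    simp [this]
  | succ m ih =>
    specialize ih fun l hl => hX l (hl.trans (Nat.le_succ m))
    have hsub : {l ∈ walks G σ y (m + 1) | ¬ Avoiding X l} ⊆
        ({l ∈ walks G σ y m | ¬ Avoiding X l}.biUnion fun l =>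
          (G.neighborFinset (σ (l.headD y))).image (· :: l)) ∪
        (walks G σ y m).biUnion fun l => (X l).image (· :: l) := by
      intro l hl
      rw [mem_filter, mem_walks_succ] at hl
      obtain ⟨⟨v, l', rfl, hl', hv⟩, hbad⟩ := hl
      simp only [mem_union, mem_biUnion, mem_image, mem_filter, SimpleGraph.mem_neighborFinset]
      by_cases hg : Avoiding X l'
      · right
        exact ⟨l', hl', v, by_contra fun h => hbad (.cons h hg), rfl⟩
      · left
        exact ⟨l', ⟨hl', hg⟩, v, hv, rfl⟩
    have h1 := (Finset.card_le_card hsub).trans (Finset.card_union_le _ _)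
    have h2 : #({l ∈ walks G σ y m | ¬ Avoiding X l}.biUnion fun l =>
          (G.neighborFinset (σ (l.headD y))).image (· :: l)) ≤
        #{l ∈ walks G σ y m | ¬ Avoiding X l} * d :=
      Finset.card_biUnion_le_card_mul _ _ d fun l _ => Finset.card_image_le.trans (by simp [hd])
    have h3 : #((walks G σ y m).biUnion fun l => (X l).image (· :: l)) ≤ d ^ m * K :=
      (Finset.card_biUnion_le_card_mul _ _ K fun l hl => Finset.card_image_le.trans
        (hX l ((mem_walks_iff G σ).1 hl).1.le)).trans
        (Nat.mul_le_mul_right K (card_walks_le G σ hd y m))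
    calc _ ≤ (m * K * d ^ m + d ^ m * K) * d :=
          Nat.mul_le_mul_right d (h1.trans (add_le_add (h2.trans ih) h3))
      _ = _ := by ring

end Walks

/-- `σ` maps each vertex to its partner in the perfect matching `M` of `G`. -/
structure IsMate {V : Type*} (G : SimpleGraph V) (M : Finset (Sym2 V)) (σ : V → V) : Prop where
  mem_iff : ∀ v w, s(v, w) ∈ M ↔ w = σ v
  adj : ∀ v, G.Adj v (σ v)

section Mate

variable {V : Type*} {G : SimpleGraph V} {M : Finset (Sym2 V)} {σ : V → V}

lemma IsMate.mem (h : IsMate G M σ) (v : V) : s(v, σ v) ∈ M := (h.mem_iff _ _).2 rfl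

lemma IsMate.involutive (h : IsMate G M σ) : Function.Involutive σ := fun v =>
  ((h.mem_iff _ _).1 (Sym2.eq_swap ▸ h.mem v)).symm

lemma IsMate.eq_of_mem (h : IsMate G M σ) {e : Sym2 V} (he : e ∈ M) {v : V} (hv : v ∈ e) :
    e = s(v, σ v) := by
  obtain ⟨w, rfl⟩ := Sym2.mem_iff_exists.1 hv
  rw [(h.mem_iff _ _).1 he]

lemma IsPM.exists_isMate (h : IsPM G M) : ∃ σ, IsMate G M σ := by
  choose e he huniq using h.2
  have : ∀ v, ∃ w, e v = s(v, w) := fun v => Sym2.mem_iff_exists.1 (he v).2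
  choose σ hσ using this
  refine ⟨σ, fun v w => ⟨fun hvw => ?_, ?_⟩, fun v => ?_⟩
  · have := huniq v _ ⟨hvw, Sym2.mem_mk_left v w⟩
    rw [hσ v] at this
    exact Sym2.congr_right.1 this
  · rintro rfl
    exact hσ v ▸ (he v).1
  · exact h.1 _ (hσ v ▸ (he v).1)

end Mate

/-- The edges of the closed walk `p 0, p 1, …, p m = p 0`. -/
def cycleEdges {V : Type*} [DecidableEq V] (p : ℕ → V) (m : ℕ) : Finset (Sym2 V) :=
  (Finset.range m).image fun i => s(p i, p (i + 1))

/-- `p` runs periodically through a cycle of length `2 * ℓ` of `G`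
whose edges `s(p (2 * i), p (2 * i + 1))` are those between partners under `σ`. -/
structure IsAlternating {V : Type*} (G : SimpleGraph V) (σ : V → V) (p : ℕ → V) (ℓ : ℕ) :
    Prop where
  eq_iff : ∀ a b, p a = p b ↔ a ≡ b [MOD 2 * ℓ]
  mate : ∀ i, σ (p (2 * i)) = p (2 * i + 1)
  adj : ∀ i, G.Adj (p (2 * i + 1)) (p (2 * i + 2))

section Cycle

variable {V : Type*} [DecidableEq V] {p : ℕ → V}

lemma mem_cycleEdges {m : ℕ} (hm : 0 < m) (hp : ∀ a b, p a = p b ↔ a ≡ b [MOD m])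
    {e : Sym2 V} : e ∈ cycleEdges p m ↔ ∃ i, s(p i, p (i + 1)) = e := by
  simp only [cycleEdges, mem_image, mem_range]
  constructor
  · rintro ⟨i, -, h⟩
    exact ⟨i, h⟩
  · rintro ⟨i, h⟩
    refine ⟨i % m, Nat.mod_lt _ hm, ?_⟩
    rw [(hp (i % m) i).2 (Nat.mod_modEq i m),
      (hp (i % m + 1) (i + 1)).2 ((Nat.mod_modEq i m).add_right 1), h]

lemma finRotate_val {m : ℕ} (i : Fin m) : (finRotate m i : ℕ) = (i + 1) % m := by
  obtain _ | m := m
  · exact i.elim0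
  rw [coe_finRotate]
  split_ifs with h
  · simp [h]
  · rw [Nat.mod_eq_of_lt]
    have := i.2
    have : (i : ℕ) ≠ m := fun h' => h (Fin.ext h')
    omega

lemma isCycleEdgeSet_cycleEdges {m : ℕ} (hm : 3 ≤ m)
    (hp : ∀ a b, p a = p b ↔ a ≡ b [MOD m]) : IsCycleEdgeSet (cycleEdges p m) m := by
  refine ⟨fun i => p i, fun i j hij => ?_, ?_, ?_⟩
  · exact Fin.ext (((hp _ _).1 hij).eq_of_lt_of_lt i.2 j.2)
  · ext e
    simp only [mem_cycleEdges (by omega : 0 < m) hp, mem_image, mem_univ, true_and,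
      finRotate_val, fun a => (hp (a % m) a).2 (Nat.mod_modEq a m)]
    constructor
    · rintro ⟨i, h⟩
      refine ⟨⟨i % m, Nat.mod_lt _ (by omega)⟩, ?_⟩
      rw [← h, (hp (i % m) i).2 (Nat.mod_modEq i m),
        (hp (i % m + 1) (i + 1)).2 ((Nat.mod_modEq i m).add_right 1)]
    · rintro ⟨i, h⟩
      exact ⟨i, h⟩
  · rw [cycleEdges, Finset.card_image_of_injOn, card_range]
    intro i hi j hj hij
    simp only [coe_range, Set.mem_Iio] at hi hj
    rw [Sym2.eq_iff] at hij
    rcases hij with ⟨h, -⟩ | ⟨h1, h2⟩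
    · exact ((hp _ _).1 h).eq_of_lt_of_lt hi hj
    · exfalso
      rw [hp] at h1 h2
      have h3 : j + 1 + 1 ≡ j + 0 [MOD m] := (h1.symm.add_right 1).trans h2
      have h4 := Nat.ModEq.add_left_cancel' j
        (by simpa [add_assoc] using h3 : j + 2 ≡ j + 0 [MOD m])
      exact absurd (h4.eq_of_lt_of_lt (by omega) (by omega)) (by norm_num)

lemma exists_pow_of_isCycleEdgeSet {E : Finset (Sym2 V)} {m : ℕ} (hm : 3 ≤ m)
    (hE : IsCycleEdgeSet E m) {x y : V} (hxy : s(x, y) ∈ E) :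
    ∃ p : ℕ → V, (∀ a b, p a = p b ↔ a ≡ b [MOD m]) ∧ E = cycleEdges p m ∧
      p 0 = x ∧ p (m - 1) = y := by
  obtain ⟨c, hc, rfl, -⟩ := hE
  have hm0 : (m : ℤ) ≠ 0 := by omega
  have hlt : ∀ a : ℤ, (a % m).toNat < m := fun a => by
    have := Int.emod_nonneg a hm0
    have := Int.emod_lt_of_pos a (by omega : (0 : ℤ) < m)
    omega
  set C : ℤ → V := fun a => c ⟨(a % m).toNat, hlt a⟩ with hCdef
  have hC : ∀ a b, C a = C b ↔ a ≡ b [ZMOD m] := by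
    intro a b
    simp only [hCdef, hc.eq_iff, Fin.mk.injEq, Int.ModEq]
    have := Int.emod_nonneg a hm0
    have := Int.emod_nonneg b hm0
    omega
  have hc0 : ∀ i : Fin m, c i = C (i : ℕ) := by
    intro i
    simp only [hCdef]
    congr 1
    ext
    simp only
    rw [Int.emod_eq_of_lt (by omega) (by have := i.2; omega)]
    simp
  have hc1 : ∀ i : Fin m, c (finRotate m i) = C ((i : ℕ) + 1) := by
    intro i
    simp only [hCdef]
    congr 1
    ext
    rw [finRotate_val]
    simp only
    rw [← Nat.cast_add_one, ← Int.natCast_emod, Int.toNat_natCast]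
  have hmem : ∀ e, e ∈ (univ.image fun i : Fin m => s(c i, c (finRotate m i))) ↔
      ∃ a : ℤ, s(C a, C (a + 1)) = e := by
    intro e
    simp only [mem_image, mem_univ, true_and, hc1]
    simp only [hc0]
    constructor
    · rintro ⟨i, h⟩
      exact ⟨_, h⟩
    · rintro ⟨a, h⟩
      refine ⟨⟨(a % m).toNat, hlt a⟩, ?_⟩
      have h0 : (((a % m).toNat : ℕ) : ℤ) ≡ a [ZMOD m] := by
        rw [Int.toNat_of_nonneg (Int.emod_nonneg a hm0)]
        exact Int.mod_modEq a m
      simp only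
      rw [← h, (hC _ _).2 h0, (hC _ _).2 (h0.add_right 1)]
  have hnat : ∀ a b : ℕ, ((a : ℤ) ≡ b [ZMOD m]) ↔ a ≡ b [MOD m] := fun a b =>
    Int.natCast_modEq_iff
  obtain ⟨a, ha⟩ := (hmem _).1 hxy
  have hm1 : ((m - 1 : ℕ) : ℤ) = m - 1 := by omega
  rcases Sym2.eq_iff.1 ha with ⟨h1, h2⟩ | ⟨h1, h2⟩
  · have hp : ∀ i j : ℕ, C (a - i) = C (a - j) ↔ i ≡ j [MOD m] := by
      intro i j
      rw [hC, ← hnat]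
      constructor
      · intro h
        simpa using h.symm.sub_left a |>.symm
      · intro h
        exact h.sub_left a
    refine ⟨fun i => C (a - i), hp, ?_, by simpa using h1, ?_⟩
    · ext e
      rw [hmem, mem_cycleEdges (by omega) hp]
      constructor
      · rintro ⟨b, rfl⟩
        refine ⟨((a - 1 - b) % m).toNat, ?_⟩
        have h0 : ((((a - 1 - b) % m).toNat : ℕ) : ℤ) ≡ a - 1 - b [ZMOD m] := by
          rw [Int.toNat_of_nonneg (Int.emod_nonneg _ hm0)]
          exact Int.mod_modEq _ m
        rw [Sym2.eq_swap]
        refine congrArg₂ (fun u v => s(u, v)) ((hC _ _).2 ?_) ((hC _ _).2 ?_)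
        · push_cast
          have h3 := (h0.add_right 1).sub_left a
          rwa [show a - (a - 1 - b + 1) = b by ring] at h3
        · simpa [sub_sub, add_comm] using h0.sub_left a
      · rintro ⟨i, rfl⟩
        refine ⟨a - i - 1, ?_⟩
        rw [Sym2.eq_swap]
        push_cast
        rw [sub_add_cancel, sub_sub]
    · rw [← h2, hC, hm1]
      exact Int.modEq_iff_dvd.2 ⟨1, by ring⟩
  · have hp : ∀ i j : ℕ, C (a + 1 + i) = C (a + 1 + j) ↔ i ≡ j [MOD m] := by
      intro i j
      rw [hC, ← hnat]
      exact ⟨fun h => Int.ModEq.add_left_cancel' _ h, fun h => h.add_left _⟩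
    refine ⟨fun i => C (a + 1 + i), hp, ?_, by simpa using h2, ?_⟩
    · ext e
      rw [hmem, mem_cycleEdges (by omega) hp]
      constructor
      · rintro ⟨b, rfl⟩
        refine ⟨((b - (a + 1)) % m).toNat, ?_⟩
        have h0 : ((((b - (a + 1)) % m).toNat : ℕ) : ℤ) ≡ b - (a + 1) [ZMOD m] := by
          rw [Int.toNat_of_nonneg (Int.emod_nonneg _ hm0)]
          exact Int.mod_modEq _ m
        have h3 := h0.add_left (a + 1)
        rw [add_sub_cancel] at h3
        refine congrArg₂ (fun u v => s(u, v)) ((hC _ _).2 h3) ((hC _ _).2 ?_)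
        push_cast
        rw [← add_assoc]
        exact h3.add_right 1
      · rintro ⟨i, rfl⟩
        exact ⟨a + 1 + i, by push_cast; rw [add_assoc (a + 1)]⟩
    · rw [← h1, hC, hm1]
      exact Int.modEq_iff_dvd.2 ⟨-1, by ring⟩

end Cycle

section Alternating

variable {V : Type*} {G : SimpleGraph V} {M' : Finset (Sym2 V)} {σ : V → V}
  {p : ℕ → V} {ℓ : ℕ}

lemma mod_two_eq_of_modEq {a b : ℕ} (h : a ≡ b [MOD 2 * ℓ]) : a % 2 = b % 2 :=
  Nat.ModEq.of_mul_right ℓ h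

lemma IsAlternating.even_edge_mem (hp : IsAlternating G σ p ℓ) (hM' : IsMate G M' σ) (i : ℕ) :
    s(p (2 * i), p (2 * i + 1)) ∈ M' := by
  rw [hM'.mem_iff, hp.mate]

lemma IsAlternating.mate_odd (hp : IsAlternating G σ p ℓ) (hM' : IsMate G M' σ) (i : ℕ) :
    σ (p (2 * i + 1)) = p (2 * i) := by
  rw [← hp.mate, hM'.involutive]

lemma IsAlternating.odd_edge_notMem (hp : IsAlternating G σ p ℓ) (hM' : IsMate G M' σ)
    (hℓ : 2 ≤ ℓ) (i : ℕ) : s(p (2 * i + 1), p (2 * i + 2)) ∉ M' := by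
  rw [hM'.mem_iff, hp.mate_odd hM', hp.eq_iff]
  intro h
  have := Nat.ModEq.add_left_cancel' (2 * i) (show 2 * i + 2 ≡ 2 * i + 0 [MOD 2 * ℓ] from h)
  exact absurd (this.eq_of_lt_of_lt (by omega) (by omega)) (by norm_num)

variable [DecidableEq V]

lemma IsAlternating.mem_cycleEdges_iff (hp : IsAlternating G σ p ℓ) (hℓ : 2 ≤ ℓ)
    {e : Sym2 V} : e ∈ cycleEdges p (2 * ℓ) ↔
      (∃ i, s(p (2 * i), p (2 * i + 1)) = e) ∨ ∃ i, s(p (2 * i + 1), p (2 * i + 2)) = e := by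
  rw [mem_cycleEdges (by omega) hp.eq_iff]
  constructor
  · rintro ⟨i, rfl⟩
    rcases Nat.even_or_odd' i with ⟨j, rfl | rfl⟩
    · exact .inl ⟨j, rfl⟩
    · exact .inr ⟨j, rfl⟩
  · rintro (⟨i, rfl⟩ | ⟨i, rfl⟩)
    · exact ⟨2 * i, rfl⟩
    · exact ⟨2 * i + 1, rfl⟩

lemma IsAlternating.mem_symmDiff_iff (hp : IsAlternating G σ p ℓ) (hM' : IsMate G M' σ)
    (hℓ : 2 ≤ ℓ) {e : Sym2 V} : e ∈ symmDiff M' (cycleEdges p (2 * ℓ)) ↔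
      (e ∈ M' ∧ ∀ i, s(p (2 * i), p (2 * i + 1)) ≠ e) ∨
        ∃ i, s(p (2 * i + 1), p (2 * i + 2)) = e := by
  rw [Finset.mem_symmDiff, hp.mem_cycleEdges_iff hℓ]
  constructor
  · rintro (⟨h1, h2⟩ | ⟨⟨i, rfl⟩ | h1, h2⟩)
    · push Not at h2
      exact .inl ⟨h1, h2.1⟩
    · exact absurd (hp.even_edge_mem hM' i) h2
    · exact .inr h1
  · rintro (⟨h1, h2⟩ | ⟨i, rfl⟩)
    · refine .inl ⟨h1, ?_⟩
      rintro (⟨i, h⟩ | ⟨i, rfl⟩)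
      · exact h2 i h
      · exact hp.odd_edge_notMem hM' hℓ i h1
    · exact .inr ⟨.inr ⟨i, rfl⟩, hp.odd_edge_notMem hM' hℓ i⟩

lemma IsAlternating.isPM_symmDiff (hp : IsAlternating G σ p ℓ) (hM' : IsMate G M' σ)
    (hpm : IsPM G M') (hℓ : 2 ≤ ℓ) : IsPM G (symmDiff M' (cycleEdges p (2 * ℓ))) := by
  simp only [IsPM, hp.mem_symmDiff_iff hM' hℓ]
  constructor
  · rintro e (⟨h, -⟩ | ⟨i, rfl⟩)
    · exact hpm.1 e h
    · exact hp.adj i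
  intro v
  have odd_unique : ∀ i j, (p (2 * i + 1) ∈ s(p (2 * j + 1), p (2 * j + 2)) ∨
      p (2 * i + 2) ∈ s(p (2 * j + 1), p (2 * j + 2))) →
      s(p (2 * j + 1), p (2 * j + 2)) = s(p (2 * i + 1), p (2 * i + 2)) := by
    intro i j h
    simp only [Sym2.mem_iff, hp.eq_iff] at h
    have h' : 2 * i + 1 ≡ 2 * j + 1 [MOD 2 * ℓ] := by
      rcases h with (h | h) | (h | h)
      · exact h
      · have := mod_two_eq_of_modEq h; omega
      · have := mod_two_eq_of_modEq h; omega
      · exact Nat.ModEq.add_right_cancel' 1 h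
    rw [(hp.eq_iff _ _).2 h', (hp.eq_iff _ _).2 (h'.add_right 1)]
  have on_cycle : ∀ i, v = p (2 * i + 1) ∨ v = p (2 * i + 2) →
      ∃! e, ((e ∈ M' ∧ ∀ i, s(p (2 * i), p (2 * i + 1)) ≠ e) ∨
        ∃ i, s(p (2 * i + 1), p (2 * i + 2)) = e) ∧ v ∈ e := by
    intro i hv
    refine ⟨s(p (2 * i + 1), p (2 * i + 2)), ⟨.inr ⟨i, rfl⟩, by simpa using hv⟩, ?_⟩
    rintro e ⟨⟨he, hne⟩ | ⟨j, rfl⟩, hve⟩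
    · exfalso
      have := hM'.eq_of_mem he hve
      rcases hv with rfl | rfl
      · rw [hp.mate_odd hM', Sym2.eq_swap] at this
        exact hne _ this.symm
      · rw [show 2 * i + 2 = 2 * (i + 1) by ring, hp.mate] at this
        exact hne _ this.symm
    · exact odd_unique i j (by rcases hv with rfl | rfl <;> simp [hve])
  by_cases hv : ∃ k, v = p k
  · obtain ⟨k, rfl⟩ := hv
    rcases Nat.even_or_odd' k with ⟨j, rfl | rfl⟩
    · refine on_cycle (j + ℓ - 1) (.inr ?_)
      rw [hp.eq_iff, show 2 * (j + ℓ - 1) + 2 = 2 * j + 2 * ℓ by omega]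
      exact (Nat.add_mod_right _ _).symm
    · exact on_cycle j (.inl rfl)
  · push Not at hv
    refine ⟨s(v, σ v), ⟨.inl ⟨hM'.mem v, fun i h => ?_⟩, Sym2.mem_mk_left _ _⟩, ?_⟩
    · rcases Sym2.eq_iff.1 h with ⟨h, -⟩ | ⟨-, h⟩
      · exact hv _ h.symm
      · exact hv _ h.symm
    · rintro e ⟨⟨he, -⟩ | ⟨i, rfl⟩, hve⟩
      · exact hM'.eq_of_mem he hve
      · rcases Sym2.mem_iff.1 hve with h | h <;> exact absurd h (hv _)

lemma exists_isAlternating {M : Finset (Sym2 V)} {μ : V → V} (hM' : IsMate G M' σ)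
    (hM : IsMate G M μ) (hℓ : 2 ≤ ℓ) (hE : IsCycleEdgeSet (symmDiff M M') (2 * ℓ)) {x y : V}
    (hxy : s(x, y) ∈ symmDiff M M') (hxM : s(x, y) ∈ M) :
    ∃ p, IsAlternating G σ p ℓ ∧ symmDiff M M' = cycleEdges p (2 * ℓ) ∧
      p 0 = x ∧ p (2 * ℓ - 1) = y := by
  obtain ⟨p, hp, hEp, h0, hl⟩ := exists_pow_of_isCycleEdgeSet (by omega) hE hxy
  have hm : 0 < 2 * ℓ := by omega
  have hedge : ∀ i, p (i + 1) = σ (p i) ∨ p (i + 1) = μ (p i) := by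
    intro i
    have : s(p i, p (i + 1)) ∈ symmDiff M M' := hEp ▸ (mem_cycleEdges hm hp).2 ⟨i, rfl⟩
    rcases Finset.mem_symmDiff.1 this with ⟨h, -⟩ | ⟨h, -⟩
    · exact .inr ((hM.mem_iff _ _).1 h)
    · exact .inl ((hM'.mem_iff _ _).1 h)
  have hne2 : ∀ i, p (i + 2) ≠ p i := by
    intro i h
    have := Nat.ModEq.add_left_cancel' i (show i + 2 ≡ i + 0 [MOD 2 * ℓ] from (hp _ _).1 h)
    exact absurd (this.eq_of_lt_of_lt (by omega) (by omega)) (by norm_num)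
  have hσ_of : ∀ i, p (i + 1) = μ (p i) → p (i + 2) = σ (p (i + 1)) := by
    intro i h
    refine (hedge (i + 1)).resolve_right fun h' => hne2 i ?_
    rw [h', h, hM.involutive]
  have hμ_of : ∀ i, p (i + 1) = σ (p i) → p (i + 2) = μ (p (i + 1)) := by
    intro i h
    refine (hedge (i + 1)).resolve_left fun h' => hne2 i ?_
    rw [h', h, hM'.involutive]
  have hwrap : p (2 * ℓ) = p 0 := (hp _ _).2 (by simp [Nat.ModEq])
  have hall : ∀ i, p (2 * i + 1) = σ (p (2 * i)) := by
    intro i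
    induction i with
    | zero =>
      have h1 := hσ_of (2 * ℓ - 1) (by
        rw [Nat.sub_add_cancel (by omega), hwrap, hl, h0]
        exact (hM.mem_iff _ _).1 (Sym2.eq_swap ▸ hxM))
      rw [show 2 * ℓ - 1 + 2 = 2 * ℓ + 1 by omega, show 2 * ℓ - 1 + 1 = 2 * ℓ by omega,
        hwrap] at h1
      rw [mul_zero, ← h1, hp]
      simp [Nat.ModEq]
    | succ i ih => exact hσ_of _ (hμ_of _ ih)
  refine ⟨p, ⟨hp, fun i => (hall i).symm, fun i => ?_⟩, hEp, h0, hl⟩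
  rw [hμ_of _ (hall i)]
  exact hM.adj _

end Alternating

/-- The `2 * ℓ`-periodic sequence `σ (v 0), v 0, σ (v 1), v 1, …, σ (v (ℓ - 1)), v (ℓ - 1), …`. -/
def altSeq {V : Type*} (σ : V → V) (ℓ : ℕ) (v : ℕ → V) (k : ℕ) : V :=
  if k % 2 = 0 then σ (v (k / 2 % ℓ)) else v (k / 2 % ℓ)

section AltSeq

variable {V : Type*} {G : SimpleGraph V} {M' : Finset (Sym2 V)} {σ : V → V} {ℓ : ℕ}
  {v : ℕ → V}

lemma altSeq_even (i : ℕ) : altSeq σ ℓ v (2 * i) = σ (v (i % ℓ)) := by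
  simp [altSeq]

lemma altSeq_odd (i : ℕ) : altSeq σ ℓ v (2 * i + 1) = v (i % ℓ) := by
  simp [altSeq, Nat.add_mod, show (2 * i + 1) / 2 = i by omega]

lemma isAlternating_altSeq (hM' : IsMate G M' σ) (hℓ : 0 < ℓ)
    (hinj : ∀ i < ℓ, ∀ j < ℓ, v i = v j → i = j)
    (hne : ∀ i < ℓ, ∀ j < ℓ, i ≠ j → v i ≠ σ (v j))
    (hadj : ∀ i < ℓ, G.Adj (v i) (σ (v ((i + 1) % ℓ)))) :
    IsAlternating G σ (altSeq σ ℓ v) ℓ := by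
  have hmod : ∀ a b : ℕ, a ≡ b [MOD 2 * ℓ] ↔ a % 2 = b % 2 ∧ a / 2 % ℓ = b / 2 % ℓ := by
    intro a b
    rw [Nat.ModEq, Nat.mod_mul, Nat.mod_mul]
    constructor
    · intro h
      have := Nat.mod_lt a (by norm_num : 0 < 2)
      have := Nat.mod_lt b (by norm_num : 0 < 2)
      omega
    · rintro ⟨h1, h2⟩
      rw [h1, h2]
  have hlt : ∀ a : ℕ, a / 2 % ℓ < ℓ := fun a => Nat.mod_lt _ hℓ
  have hne' : ∀ i < ℓ, ∀ j < ℓ, v i ≠ σ (v j) := by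
    intro i hi j hj h
    by_cases hij : i = j
    · subst hij
      exact (hM'.adj (v i)).ne h
    · exact hne i hi j hj hij h
  refine ⟨fun a b => ?_, fun i => ?_, fun i => ?_⟩
  · rw [hmod]
    simp only [altSeq]
    split_ifs with ha hb hb
    · rw [hM'.involutive.injective.eq_iff]
      exact ⟨fun h => ⟨by omega, hinj _ (hlt a) _ (hlt b) h⟩, fun h => by rw [h.2]⟩
    · exact ⟨fun h => absurd h.symm (hne' _ (hlt b) _ (hlt a)), fun h => by omega⟩
    · exact ⟨fun h => absurd h (hne' _ (hlt a) _ (hlt b)), fun h => by omega⟩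
    · exact ⟨fun h => ⟨by omega, hinj _ (hlt a) _ (hlt b) h⟩, fun h => by rw [h.2]⟩
  · rw [altSeq_even, altSeq_odd, hM'.involutive]
  · rw [altSeq_odd, show 2 * i + 2 = 2 * (i + 1) by ring, altSeq_even]
    have := hadj (i % ℓ) (Nat.mod_lt _ hℓ)
    rwa [Nat.mod_add_mod] at this

lemma altSeq_eq (hM' : IsMate G M' σ) {p : ℕ → V} (hp : IsAlternating G σ p ℓ)
    (hv : ∀ i, v (i % ℓ) = p (2 * (i % ℓ) + 1)) : altSeq σ ℓ v = p := by
  have hmod : ∀ i, 2 * (i % ℓ) ≡ 2 * i [MOD 2 * ℓ] := fun i =>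
    (Nat.mod_modEq i ℓ).mul_left' 2
  ext k
  rcases Nat.even_or_odd' k with ⟨j, rfl | rfl⟩
  · rw [altSeq_even, hv, hp.mate_odd hM', hp.eq_iff]
    exact hmod j
  · rw [altSeq_odd, hv, hp.eq_iff]
    exact (hmod j).add_right 1

variable [DecidableEq V]

lemma cycleEdges_inter_eq_singleton {p : ℕ → V} {N : Finset (Sym2 V)} {e : Sym2 V}
    (hℓ : 0 < ℓ) (heven : ∀ i < ℓ, s(p (2 * i), p (2 * i + 1)) ∉ N)
    (hodd : ∀ i, i + 1 < ℓ → s(p (2 * i + 1), p (2 * i + 2)) ∉ N)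
    (he : s(p (2 * (ℓ - 1) + 1), p (2 * (ℓ - 1) + 2)) = e) (heN : e ∈ N) :
    cycleEdges p (2 * ℓ) ∩ N = {e} := by
  ext f
  simp only [cycleEdges, mem_inter, mem_image, mem_range, mem_singleton]
  constructor
  · rintro ⟨⟨i, hi, rfl⟩, hN⟩
    rcases Nat.even_or_odd' i with ⟨j, rfl | rfl⟩
    · exact absurd hN (heven j (by omega))
    · by_cases hj : j + 1 < ℓ
      · exact absurd hN (hodd j hj)
      · rw [← he, show j = ℓ - 1 by omega]
  · rintro rfl
    exact ⟨⟨2 * (ℓ - 1) + 1, by omega, he⟩, heN⟩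

end AltSeq

/-- The vertices which may not extend the walk `l`, which starts at `y` and is to be continued
to `σ x`, if it is to close up to an alternating cycle whose only edge in `N` is `s(x, y)`. -/
def forbidden {V : Type*} [Fintype V] [DecidableEq V] (N : Finset (Sym2 V)) (σ : V → V)
    (x y : V) (l : List V) : Finset V :=
  (l.toFinset ∪ l.toFinset.image σ) ∪ ({σ x, x} ∪ (({v | s(v, σ (l.headD y)) ∈ N} : Finset V) ∪
    (({v | s(σ x, σ v) ∈ N} : Finset V) ∪ ({v | s(v, σ v) ∈ N} : Finset V))))

/-- The perfect matching obtained from `M'` by switching along the alternating cycle through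
the vertices of the walk `l` and their partners under `σ`. -/
def switch {V : Type*} [DecidableEq V] (M' : Finset (Sym2 V)) (σ : V → V) (ℓ : ℕ) (y : V)
    (l : List V) : Finset (Sym2 V) :=
  symmDiff M' (cycleEdges (altSeq σ ℓ fun i => l.getD i y) (2 * ℓ))

/-- `M` is obtained from `M'` by switching along a cycle of length `2 * ℓ`
which has exactly one edge in `N`, and has `k` edges in `N`. -/
def IsSwitching {V : Type*} [DecidableEq V] (G : SimpleGraph V) (N M' : Finset (Sym2 V))
    (k ℓ : ℕ) (M : Finset (Sym2 V)) : Prop :=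
  IsPM G M ∧ (M ∩ N).card = k ∧ IsCycleEdgeSet (symmDiff M M') (2 * ℓ) ∧
    ((symmDiff M M') ∩ N).card = 1

section Switch

variable {V : Type*} {G : SimpleGraph V} {M' N : Finset (Sym2 V)} {σ : V → V} {x y : V}

lemma IsMatchingIn.eq_of_mem (hN : IsMatchingIn G N) {a b u : V} (ha : s(a, u) ∈ N)
    (hb : s(b, u) ∈ N) : a = b := by
  by_contra hab
  refine hN.2 _ ha _ hb (fun h => hab (Sym2.congr_left.1 h)) u ?_ ?_ <;> simp

variable [Fintype V] [DecidableEq V]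

lemma card_forbidden_le (hN : IsMatchingIn G N) (hM' : IsMate G M' σ) (l : List V) :
    #(forbidden N σ x y l) ≤ 2 * l.length + 4 + 2 * #(M' ∩ N) := by
  have h1 : #l.toFinset ≤ l.length := List.toFinset_card_le l
  have h2 : #(l.toFinset.image σ) ≤ l.length := Finset.card_image_le.trans h1
  have h3 : #{σ x, x} ≤ 2 := Finset.card_le_two
  have h4 : #{v | s(v, σ (l.headD y)) ∈ N} ≤ 1 := by
    refine Finset.card_le_one.2 fun a ha b hb => ?_
    simp only [mem_filter, mem_univ, true_and] at ha hb
    exact hN.eq_of_mem ha hb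
  have h5 : #{v | s(σ x, σ v) ∈ N} ≤ 1 := by
    refine Finset.card_le_one.2 fun a ha b hb => ?_
    simp only [mem_filter, mem_univ, true_and] at ha hb
    rw [Sym2.eq_swap] at ha hb
    exact hM'.involutive.injective (hN.eq_of_mem ha hb)
  have h6 : #{v | s(v, σ v) ∈ N} ≤ 2 * #(M' ∩ N) := by
    have hsub : ({v | s(v, σ v) ∈ N} : Finset V) ⊆ (M' ∩ N).biUnion Sym2.toFinset := by
      intro v hv
      simp only [mem_filter, mem_univ, true_and] at hv
      simp only [mem_biUnion, mem_inter, Sym2.mem_toFinset]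
      exact ⟨_, ⟨hM'.mem v, hv⟩, Sym2.mem_mk_left _ _⟩
    rw [mul_comm]
    refine (Finset.card_le_card hsub).trans (Finset.card_biUnion_le_card_mul _ _ 2 fun e _ => ?_)
    rw [Sym2.card_toFinset]
    split_ifs <;> norm_num
  unfold forbidden
  refine (Finset.card_union_le _ _).trans ?_
  have u2 := Finset.card_union_le l.toFinset (l.toFinset.image σ)
  have u3 := Finset.card_union_le {σ x, x} (({v | s(v, σ (l.headD y)) ∈ N} : Finset V) ∪
    (({v | s(σ x, σ v) ∈ N} : Finset V) ∪ ({v | s(v, σ v) ∈ N} : Finset V)))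
  have u4 := Finset.card_union_le ({v | s(v, σ (l.headD y)) ∈ N} : Finset V)
    (({v | s(σ x, σ v) ∈ N} : Finset V) ∪ ({v | s(v, σ v) ∈ N} : Finset V))
  have u5 := Finset.card_union_le ({v | s(σ x, σ v) ∈ N} : Finset V)
    ({v | s(v, σ v) ∈ N} : Finset V)
  omega

lemma Avoiding.spec {l : List V} (hl : Avoiding (forbidden N σ x y) l)
    (hinv : Function.Involutive σ) (hy : l.getLast? = some y) :
    l.Pairwise (fun v u => v ≠ u ∧ v ≠ σ u) ∧ l.IsChain (fun v u => s(v, σ u) ∉ N) ∧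
      ∀ v ∈ l, v = y ∨ (σ x ≠ v ∧ σ x ≠ σ v ∧ s(σ x, σ v) ∉ N ∧ s(v, σ v) ∉ N) := by
  induction hl with
  | single w => simp_all
  | @cons v l hv hl ih =>
    match l, hl with
    | u :: l, hl =>
      obtain ⟨h1, h2, h3⟩ := ih (by simpa using hy)
      simp only [forbidden, mem_union, List.mem_toFinset, mem_image, mem_insert, mem_singleton,
        mem_filter, mem_univ, true_and, not_or, not_exists, not_and] at hv
      obtain ⟨⟨ha, hb⟩, ⟨hc, hd⟩, he, hf, hg⟩ := hv
      refine ⟨List.pairwise_cons.2 ⟨fun w hw => ⟨fun h => ha (h ▸ hw), fun h => hb w hw h.symm⟩,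
        h1⟩, List.isChain_cons_cons.2 ⟨he, h2⟩, fun w hw => ?_⟩
      rcases List.mem_cons.1 hw with rfl | hw
      · exact .inr ⟨Ne.symm hc, fun h => hd (hinv.injective h).symm, hf, hg⟩
      · exact h3 w hw

lemma Avoiding.spec_cons {l : List V} (hl : Avoiding (forbidden N σ x y) l)
    (hN : IsMatchingIn G N) (hM' : IsMate G M' σ) (hy : l.getLast? = some y)
    (hlen : 2 ≤ l.length) (hxyN : s(x, y) ∈ N) (hxyM' : s(x, y) ∉ M') :
    (σ x :: l).Pairwise (fun v u => v ≠ u ∧ v ≠ σ u) ∧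
      (σ x :: l).IsChain (fun v u => s(v, σ u) ∉ N) ∧ ∀ v ∈ σ x :: l, s(v, σ v) ∉ N := by
  obtain ⟨h1, h2, h3⟩ := hl.spec hM'.involutive hy
  have hxy : x ≠ y := fun h => by
    have := hN.1 _ hxyN
    rw [h] at this
    exact G.irrefl this
  have hσx : σ x ≠ y := fun h => hxyM' ((hM'.mem_iff _ _).2 h.symm)
  have hyx : s(y, x) ∈ N := Sym2.eq_swap ▸ hxyN
  refine ⟨List.pairwise_cons.2 ⟨fun u hu => ?_, h1⟩, ?_, fun v hv hvN => ?_⟩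
  · rcases h3 u hu with rfl | h
    · exact ⟨hσx, fun h => hxy (hM'.involutive.injective h)⟩
    · exact ⟨h.1, h.2.1⟩
  · match l, hlen with
    | u :: w :: l, _ =>
      refine List.isChain_cons_cons.2 ⟨?_, h2⟩
      rcases h3 u (by simp) with rfl | h
      · have hmem : u ∈ w :: l := List.mem_of_getLast? (by simpa using hy)
        exact absurd rfl ((List.pairwise_cons.1 h1).1 u hmem).1
      · exact h.2.2.1
  · rcases List.mem_cons.1 hv with rfl | hv
    · rw [hM'.involutive] at hvN
      exact hσx (hN.eq_of_mem hvN hyx)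
    · rcases h3 v hv with rfl | h
      · rw [Sym2.eq_swap] at hvN
        exact hσx (by rw [← hN.eq_of_mem hvN hxyN, hM'.involutive])
      · exact h.2.2.2 hvN

variable [DecidableRel G.Adj]

lemma Avoiding.isAlternating {l : List V} {L : ℕ} (hL : 2 ≤ L)
    (hl : Avoiding (forbidden N σ x y) l) (hN : IsMatchingIn G N) (hM' : IsMate G M' σ)
    (hxyN : s(x, y) ∈ N) (hxyM' : s(x, y) ∉ M') (hwalk : σ x :: l ∈ walks G σ y L) :
    IsAlternating G σ (altSeq σ (L + 1) fun i => (σ x :: l).getD i y) (L + 1) ∧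
      cycleEdges (altSeq σ (L + 1) fun i => (σ x :: l).getD i y) (2 * (L + 1)) ∩ N
        = {s(x, y)} := by
  obtain ⟨hlen, hlast, hchain⟩ := (mem_walks_iff G σ).1 hwalk
  have hlen' : l.length = L := by simpa using hlen
  have hlast' : l.getLast? = some y := by
    match l, hlen' with
    | [], h => simp at h; omega
    | u :: l, _ => simpa using hlast
  obtain ⟨h1, h2, h3⟩ := hl.spec_cons hN hM' hlast' (by omega) hxyN hxyM'
  set l' := σ x :: l with hl'
  rw [List.pairwise_iff_getElem] at h1
  rw [List.isChain_iff_getElem] at h2 hchain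
  have hget : ∀ i (hi : i < L + 1), l'.getD i y = l'[i] := fun i hi =>
    List.getD_eq_getElem l' y (by omega)
  have hv0 : l'.getD 0 y = σ x := by simp [hl']
  have hvL : l'.getD L y = y := by
    rw [hget L (by omega)]
    rw [List.getLast?_eq_getElem?, hlen, Nat.add_sub_cancel, List.getElem?_eq_getElem (by omega)]
      at hlast
    exact Option.some.inj hlast
  constructor
  · refine isAlternating_altSeq hM' (by omega) ?_ ?_ ?_
    · intro i hi j hj hij
      rw [hget i hi, hget j hj] at hij
      rcases lt_trichotomy i j with h | h | h
      · exact absurd hij (h1 i j (by omega) (by omega) h).1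
      · exact h
      · exact absurd hij.symm (h1 j i (by omega) (by omega) h).1
    · intro i hi j hj hne hij
      rw [hget i hi, hget j hj] at hij
      rcases lt_trichotomy i j with h | h | h
      · exact absurd hij (h1 i j (by omega) (by omega) h).2
      · exact hne h
      · refine (h1 j i (by omega) (by omega) h).2 ?_
        rw [hij, hM'.involutive]
    · intro i hi
      by_cases h : i + 1 < L + 1
      · rw [Nat.mod_eq_of_lt h, hget i hi, hget _ h]
        exact (hchain i (by omega)).symm
      · obtain rfl : i = L := by omega
        rw [Nat.mod_self, hvL, hv0, hM'.involutive]
        exact (show G.Adj x y from hN.1 _ hxyN).symm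
  · refine cycleEdges_inter_eq_singleton (by omega) ?_ ?_ ?_ hxyN
    · intro i hi
      rw [altSeq_even, altSeq_odd, Nat.mod_eq_of_lt hi, hget i hi, Sym2.eq_swap]
      exact h3 _ (List.getElem_mem _)
    · intro i hi
      rw [show 2 * i + 2 = 2 * (i + 1) by ring, altSeq_even, altSeq_odd,
        Nat.mod_eq_of_lt (by omega), Nat.mod_eq_of_lt hi, hget i (by omega), hget _ hi]
      exact h2 i (by omega)
    · rw [show 2 * (L + 1 - 1) + 2 = 2 * (L + 1) by omega, altSeq_even, altSeq_odd,
        Nat.add_sub_cancel, Nat.mod_self, Nat.mod_eq_of_lt (by omega), hvL, hv0,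
        hM'.involutive, Sym2.eq_swap]

lemma isSwitching_switch {l : List V} {L k : ℕ} (hL : 2 ≤ L)
    (hl : Avoiding (forbidden N σ x y) l) (hN : IsMatchingIn G N) (hpm : IsPM G M')
    (hM' : IsMate G M' σ) (hk : 1 ≤ k) (hcard : #(M' ∩ N) = k - 1)
    (hxyN : s(x, y) ∈ N) (hxyM' : s(x, y) ∉ M') (hwalk : σ x :: l ∈ walks G σ y L) :
    IsSwitching G N M' k (L + 1) (switch M' σ (L + 1) y (σ x :: l)) ∧
      symmDiff (switch M' σ (L + 1) y (σ x :: l)) M' ∩ N = {s(x, y)} := by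
  obtain ⟨halt, hone⟩ := hl.isAlternating hL hN hM' hxyN hxyM' hwalk
  have hsd : symmDiff (switch M' σ (L + 1) y (σ x :: l)) M' =
      cycleEdges (altSeq σ (L + 1) fun i => (σ x :: l).getD i y) (2 * (L + 1)) := by
    rw [switch, symmDiff_comm, symmDiff_symmDiff_cancel_left]
  refine ⟨⟨halt.isPM_symmDiff hM' hpm (by omega), ?_, ?_, ?_⟩, by rw [hsd, hone]⟩
  · have : switch M' σ (L + 1) y (σ x :: l) ∩ N = insert s(x, y) (M' ∩ N) := by
      ext e
      have he := Finset.ext_iff.1 hone e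
      simp only [switch, mem_inter, Finset.mem_symmDiff, mem_singleton, mem_insert] at he ⊢
      by_cases h : e = s(x, y)
      · subst h; tauto
      · tauto
    rw [this, Finset.card_insert_of_notMem (by simp [hxyM']), hcard]
    omega
  · rw [hsd]
    exact isCycleEdgeSet_cycleEdges (by omega) halt.eq_iff
  · rw [hsd, hone, card_singleton]

lemma switch_injOn {l₁ l₂ : List V} {L : ℕ} (hL : 2 ≤ L)
    (hl₁ : Avoiding (forbidden N σ x y) l₁) (hl₂ : Avoiding (forbidden N σ x y) l₂)
    (hN : IsMatchingIn G N) (hpm : IsPM G M') (hM' : IsMate G M' σ)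
    (hxyN : s(x, y) ∈ N) (hxyM' : s(x, y) ∉ M')
    (hwalk₁ : σ x :: l₁ ∈ walks G σ y L) (hwalk₂ : σ x :: l₂ ∈ walks G σ y L)
    (h : switch M' σ (L + 1) y (σ x :: l₁) = switch M' σ (L + 1) y (σ x :: l₂)) :
    l₁ = l₂ := by
  have halt₁ := (hl₁.isAlternating hL hN hM' hxyN hxyM' hwalk₁).1
  have halt₂ := (hl₂.isAlternating hL hN hM' hxyN hxyM' hwalk₂).1
  obtain ⟨μ, hμ⟩ := (halt₁.isPM_symmDiff hM' hpm (by omega)).exists_isMate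
  have key : ∀ l : List V, IsAlternating G σ (altSeq σ (L + 1) fun i => l.getD i y) (L + 1) →
      symmDiff M' (cycleEdges (altSeq σ (L + 1) fun i => (σ x :: l₁).getD i y) (2 * (L + 1))) =
        switch M' σ (L + 1) y l → l ∈ walks G σ y L →
      l.length = L + 1 ∧ l.getD L y = y ∧
        ∀ i < L, l.getD i y = μ (σ (l.getD (i + 1) y)) := by
    intro l halt heq hwalk
    obtain ⟨hlen, hlast, -⟩ := (mem_walks_iff G σ).1 hwalk
    refine ⟨hlen, ?_, fun i hi => ?_⟩
    · rw [List.getLast?_eq_getElem?, hlen, Nat.add_sub_cancel] at hlast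
      simp [List.getD, hlast]
    · have hmem := (halt.mem_symmDiff_iff hM' (by omega)).2 (.inr ⟨i, rfl⟩)
      rw [switch] at heq
      rw [← heq, show 2 * i + 2 = 2 * (i + 1) by ring, altSeq_even, altSeq_odd,
        Nat.mod_eq_of_lt (by omega), Nat.mod_eq_of_lt (by omega), Sym2.eq_swap, hμ.mem_iff] at hmem
      exact hmem
  obtain ⟨hlen₁, hlast₁, hrec₁⟩ := key _ halt₁ rfl hwalk₁
  obtain ⟨hlen₂, hlast₂, hrec₂⟩ := key _ halt₂ h hwalk₂
  have hall : ∀ j ≤ L, (σ x :: l₁).getD (L - j) y = (σ x :: l₂).getD (L - j) y := by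
    intro j
    induction j with
    | zero => intro _; rw [Nat.sub_zero, hlast₁, hlast₂]
    | succ j ih =>
      intro hj
      rw [hrec₁ _ (by omega), hrec₂ _ (by omega), show L - (j + 1) + 1 = L - j by omega,
        ih (by omega)]
  refine (List.cons.inj (List.ext_getElem (hlen₁.trans hlen₂.symm) fun i h₁ h₂ => ?_)).2
  have := hall (L - i) (by omega)
  rwa [show L - (L - i) = i by omega, List.getD_eq_getElem _ _ h₁,
    List.getD_eq_getElem _ _ h₂] at this

lemma IsSwitching.exists_walk {M : Finset (Sym2 V)} {L k : ℕ} (hL : 1 ≤ L) (hk : 1 ≤ k)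
    (hM : IsSwitching G N M' k (L + 1) M) (hM' : IsMate G M' σ) (hcard : #(M' ∩ N) = k - 1) :
    ∃ e ∈ N \ M', ∀ x y, e = s(x, y) →
      ∃ l ∈ walks G σ y L, l.headD y = σ x ∧ switch M' σ (L + 1) y l = M := by
  obtain ⟨hpm, hMk, hcyc, hone⟩ := hM
  obtain ⟨e, he⟩ := Finset.card_eq_one.1 hone
  have heD : e ∈ symmDiff M M' ∩ N := he ▸ mem_singleton_self e
  rw [mem_inter] at heD
  have heMM' : e ∈ M ∧ e ∉ M' := by
    rcases Finset.mem_symmDiff.1 heD.1 with h | h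
    · exact h
    · exfalso
      have hsub : M ∩ N ⊆ M' ∩ N := by
        intro f hf
        rw [mem_inter] at hf ⊢
        refine ⟨by_contra fun hfM' => ?_, hf.2⟩
        have hfD : f ∈ symmDiff M M' ∩ N :=
          mem_inter.2 ⟨Finset.mem_symmDiff.2 (.inl ⟨hf.1, hfM'⟩), hf.2⟩
        rw [he, mem_singleton] at hfD
        exact h.2 (hfD ▸ hf.1)
      have := Finset.card_le_card hsub
      omega
  refine ⟨e, mem_sdiff.2 ⟨heD.2, heMM'.2⟩, ?_⟩
  rintro x y rfl
  obtain ⟨μ, hμ⟩ := hpm.exists_isMate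
  obtain ⟨p, hp, hE, hp0, hpl⟩ :=
    exists_isAlternating hM' hμ (by omega) hcyc heD.1 heMM'.1
  set l := (List.range (L + 1)).map fun i => p (2 * i + 1) with hl
  have hlen : l.length = L + 1 := by simp [hl]
  refine ⟨l, (mem_walks_iff G σ).2 ⟨hlen, ?_, ?_⟩, ?_, ?_⟩
  · rw [List.getLast?_eq_getElem?, hlen, ← hpl]
    simp [hl, show 2 * (L + 1) - 1 = 2 * L + 1 by omega]
  · rw [List.isChain_iff_getElem]
    intro i hi
    simp only [hl, List.getElem_map, List.getElem_range]
    rw [hp.mate_odd hM']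
    exact (hp.adj i).symm
  · rw [← hp0, show p 0 = p (2 * 0) by rfl, hp.mate]
    simp [hl, List.range_succ_eq_map]
  · rw [switch, altSeq_eq hM' hp, ← hE, symmDiff_comm, symmDiff_symmDiff_cancel_right]
    intro i
    rw [List.getD_eq_getElem _ _ (by rw [hlen]; exact Nat.mod_lt _ (by omega))]
    simp [hl]

end Switch

section Counting

variable {V : Type*} [Fintype V] [DecidableEq V] {G : SimpleGraph V} [DecidableRel G.Adj]
  {M' N : Finset (Sym2 V)} {σ : V → V}

lemma exists_endpoints (V : Type*) : ∃ x y : Sym2 V → V, ∀ e, e = s(x e, y e) := by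
  have : ∀ e : Sym2 V, ∃ x y, e = s(x, y) := fun e => by
    induction e with | _ x y => exact ⟨x, y, rfl⟩
  choose x y hxy using this
  exact ⟨x, y, hxy⟩

lemma card_isSwitching_le {L k : ℕ} (hL : 1 ≤ L) (hk : 1 ≤ k) (hM' : IsMate G M' σ)
    (hcard : #(M' ∩ N) = k - 1) {B : ℝ} (hB : ∀ y z, (walkMatrix G σ ^ L) y z ≤ B) :
    (Nat.card {M // IsSwitching G N M' k (L + 1) M} : ℝ) ≤ #(N \ M') * B := by
  classical
  obtain ⟨x, y, hxy⟩ := exists_endpoints V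
  have hsub : ({M | IsSwitching G N M' k (L + 1) M} : Finset (Finset (Sym2 V))) ⊆
      (N \ M').biUnion fun e => ({l ∈ walks G σ (y e) L | l.headD (y e) = σ (x e)}).image
        (switch M' σ (L + 1) (y e)) := by
    intro M hM
    obtain ⟨e, he, h⟩ := (mem_filter.1 hM).2.exists_walk hL hk hM' hcard
    obtain ⟨l, hl, hl', rfl⟩ := h _ _ (hxy e)
    exact mem_biUnion.2 ⟨e, he, mem_image_of_mem _ (mem_filter.2 ⟨hl, hl'⟩)⟩
  rw [Nat.card_eq_fintype_card, Fintype.card_subtype]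
  calc (#{M | IsSwitching G N M' k (L + 1) M} : ℝ)
      ≤ ∑ e ∈ N \ M', #{l ∈ walks G σ (y e) L | l.headD (y e) = σ (x e)} :=
        mod_cast (card_le_card hsub).trans (card_biUnion_le.trans
          (sum_le_sum fun e _ => card_image_le))
    _ ≤ ∑ e ∈ N \ M', B := by
        push_cast
        exact sum_le_sum fun e _ => (card_walks_headD_eq G σ _ _ L).trans_le (hB _ _)
    _ = #(N \ M') * B := by rw [sum_const, nsmul_eq_mul]

open Classical in
lemma le_card_isSwitching {L k : ℕ} (hL : 2 ≤ L) (hk : 1 ≤ k) (hN : IsMatchingIn G N)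
    (hpm : IsPM G M') (hM' : IsMate G M' σ) (hcard : #(M' ∩ N) = k - 1) {B : ℝ}
    (hB : ∀ x y, B ≤ #{l ∈ walks G σ y L |
      l.headD y = σ x ∧ Avoiding (forbidden N σ x y) l.tail}) :
    #(N \ M') * B ≤ (Nat.card {M // IsSwitching G N M' k (L + 1) M} : ℝ) := by
  obtain ⟨x, y, hxy⟩ := exists_endpoints V
  have hcons : ∀ e, ∀ l ∈ walks G σ (y e) L, l.headD (y e) = σ (x e) → l = σ (x e) :: l.tail := by
    intro e l hl hhead
    have := ((mem_walks_iff G σ).1 hl).1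
    cases l with
    | nil => simp at this
    | cons v l => simpa using hhead
  have hmem : ∀ e ∈ N \ M', s(x e, y e) ∈ N ∧ s(x e, y e) ∉ M' := fun e he =>
    hxy e ▸ mem_sdiff.1 he
  set good : Sym2 V → Finset (List V) := fun e => {l ∈ walks G σ (y e) L |
    l.headD (y e) = σ (x e) ∧ Avoiding (forbidden N σ (x e) (y e)) l.tail} with hgood
  have hspec : ∀ e ∈ N \ M', ∀ l ∈ good e,
      IsSwitching G N M' k (L + 1) (switch M' σ (L + 1) (y e) l) ∧
        symmDiff (switch M' σ (L + 1) (y e) l) M' ∩ N = {e} := by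
    intro e he l hl
    obtain ⟨hl, hhead, hav⟩ := mem_filter.1 hl
    have hl' := hcons e l hl hhead
    have := isSwitching_switch hL hav hN hpm hM' hk hcard (hmem e he).1 (hmem e he).2 (hl' ▸ hl)
    rwa [← hl', ← hxy] at this
  have hinj : ∀ e ∈ N \ M', Set.InjOn (switch M' σ (L + 1) (y e)) (good e) := by
    intro e he l₁ h₁ l₂ h₂ h
    obtain ⟨h₁, hhead₁, hav₁⟩ := mem_filter.1 h₁
    obtain ⟨h₂, hhead₂, hav₂⟩ := mem_filter.1 h₂
    have h₁' := hcons e l₁ h₁ hhead₁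
    have h₂' := hcons e l₂ h₂ hhead₂
    rw [h₁', h₂'] at h
    rw [h₁', h₂', switch_injOn hL hav₁ hav₂ hN hpm hM' (hmem e he).1 (hmem e he).2 (h₁' ▸ h₁)
      (h₂' ▸ h₂) h]
  have hsub : (N \ M').biUnion (fun e => (good e).image (switch M' σ (L + 1) (y e))) ⊆
      ({M | IsSwitching G N M' k (L + 1) M} : Finset (Finset (Sym2 V))) := by
    intro M hM
    obtain ⟨e, he, hM⟩ := mem_biUnion.1 hM
    obtain ⟨l, hl, rfl⟩ := mem_image.1 hM
    exact mem_filter.2 ⟨mem_univ _, (hspec e he l hl).1⟩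
  have hdisj : Set.PairwiseDisjoint ↑(N \ M')
      fun e => (good e).image (switch M' σ (L + 1) (y e)) := by
    intro e he f hf hef
    simp only [Function.onFun, disjoint_left, mem_image]
    rintro _ ⟨l, hl, rfl⟩ ⟨l', hl', h⟩
    refine hef (singleton_injective ?_)
    rw [← (hspec e he l hl).2, ← h, (hspec f hf l' hl').2]
  rw [Nat.card_eq_fintype_card, Fintype.card_subtype]
  calc #(N \ M') * B = ∑ e ∈ N \ M', B := by rw [sum_const, nsmul_eq_mul]
    _ ≤ ∑ e ∈ N \ M', (#(good e) : ℝ) := sum_le_sum fun e _ => hB _ _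
    _ = #((N \ M').biUnion fun e => (good e).image (switch M' σ (L + 1) (y e))) := by
        rw [card_biUnion hdisj]
        push_cast
        exact sum_congr rfl fun e he => by rw [card_image_of_injOn (hinj e he)]
    _ ≤ _ := mod_cast card_le_card hsub

open Classical in
lemma pow_walkMatrix_le_card_avoiding {d : ℕ} (hd : ∀ v, G.degree v = d) (hd0 : 0 < d)
    (y z : V) (X : List V → Finset V) (K m : ℕ) (hX : ∀ l : List V, l.length ≤ m → #(X l) ≤ K) :
    (walkMatrix G σ ^ (m + 1)) y z - m * K * (d : ℝ) ^ (m + 1) / (d : ℝ) ^ 2 ≤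
      #{l ∈ walks G σ y (m + 1) | l.headD y = z ∧ Avoiding X l.tail} := by
  rw [← card_walks_headD_eq,
    ← card_filter_add_card_filter_not (fun l => Avoiding X l.tail), filter_filter, filter_filter]
  have htail : #{l ∈ walks G σ y (m + 1) | l.headD y = z ∧ ¬ Avoiding X l.tail} ≤
      #{l ∈ walks G σ y m | ¬ Avoiding X l} := by
    refine card_le_card_of_injOn List.tail ?_ ?_
    · intro l hl
      simp only [coe_filter, Set.mem_ofPred_eq, mem_walks_succ] at hl ⊢
      obtain ⟨⟨v, l', rfl, hl', -⟩, -, h⟩ := hl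
      exact ⟨hl', h⟩
    · intro l₁ h₁ l₂ h₂ h
      simp only [coe_filter, Set.mem_ofPred_eq, mem_walks_succ] at h₁ h₂
      obtain ⟨⟨v₁, l₁', rfl, -⟩, h₁, -⟩ := h₁
      obtain ⟨⟨v₂, l₂', rfl, -⟩, h₂, -⟩ := h₂
      simp_all
  have hbad := card_not_avoiding_mul_le G σ hd y X K m hX
  have hd0' : (0 : ℝ) < d := by exact_mod_cast hd0
  have : (#{l ∈ walks G σ y m | ¬ Avoiding X l} : ℝ) ≤
      m * K * (d : ℝ) ^ (m + 1) / (d : ℝ) ^ 2 := by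
    rw [le_div_iff₀ (by positivity), pow_two, pow_succ, ← mul_assoc, ← mul_assoc]
    exact mul_le_mul_of_nonneg_right (by exact_mod_cast hbad) hd0'.le
  have htail' : (#{l ∈ walks G σ y (m + 1) | l.headD y = z ∧ ¬ Avoiding X l.tail} : ℝ) ≤
      #{l ∈ walks G σ y m | ¬ Avoiding X l} := by exact_mod_cast htail
  push_cast
  linarith

lemma card_isSwitching_mem_interval {d m k : ℕ} {ε : ℝ} (hd : ∀ v, G.degree v = d)
    (hd0 : 0 < d) (hm : 1 ≤ m) (hk : 1 ≤ k) (hN : IsMatchingIn G N) (hpm : IsPM G M')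
    (hM' : IsMate G M' σ) (hcard : #(M' ∩ N) = k - 1)
    (hmix : ∀ y z, |(walkMatrix G σ ^ (m + 1)) y z - (d : ℝ) ^ (m + 1) / Fintype.card V|
      ≤ (d : ℝ) ^ (m + 1) / Fintype.card V * ε)
    (havoid : (m * (2 * m + 2 * k + 2) : ℝ) / (d : ℝ) ^ 2 ≤ ε / Fintype.card V) :
    #(N \ M') * ((1 - 2 * ε) * ((d : ℝ) ^ (m + 1) / Fintype.card V)) ≤
        (Nat.card {M // IsSwitching G N M' k (m + 2) M} : ℝ) ∧
      (Nat.card {M // IsSwitching G N M' k (m + 2) M} : ℝ) ≤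
        #(N \ M') * ((1 + ε) * ((d : ℝ) ^ (m + 1) / Fintype.card V)) := by
  classical
  refine ⟨le_card_isSwitching (by omega) hk hN hpm hM' hcard fun x y => ?_,
    card_isSwitching_le (by omega) hk hM' hcard fun y z => ?_⟩
  · refine le_trans ?_ (pow_walkMatrix_le_card_avoiding hd hd0 y (σ x) (forbidden N σ x y)
      (2 * m + 2 * k + 2) m fun l hl => (card_forbidden_le hN hM' l).trans (by omega))
    have h1 := (abs_le.1 (hmix y (σ x))).1
    have h2 := mul_le_mul_of_nonneg_left havoid (by positivity : 0 ≤ (d : ℝ) ^ (m + 1))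
    have h3 : (m * (2 * m + 2 * k + 2 : ℕ) * (d : ℝ) ^ (m + 1) / (d : ℝ) ^ 2 : ℝ) =
      (d : ℝ) ^ (m + 1) * (m * (2 * m + 2 * k + 2) / (d : ℝ) ^ 2) := by push_cast; ring
    have h4 : (d : ℝ) ^ (m + 1) * (ε / Fintype.card V) =
        (d : ℝ) ^ (m + 1) / Fintype.card V * ε := by ring
    rw [h3]
    linarith
  · have := (abs_le.1 (hmix y z)).2
    linarith

end Counting

section Asymptotics

open Filter

lemma eventually_pow_div_mul_le {r : ℝ} (hr0 : 0 ≤ r) (hr1 : r < 1) {s : ℕ} (hs : 0 < s) :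
    ∀ᶠ n : ℕ in atTop,
      r ^ (⌈Real.log n ^ 2⌉₊ / s) * n ≤ (n : ℝ) ^ (-(1 / 6) : ℝ) := by
  set q := max r (1 / 2) with hq
  have hq0 : 0 < q := lt_max_of_lt_right (by norm_num)
  have hq1 : q < 1 := max_lt hr1 (by norm_num)
  have hc : 0 < -Real.log q := neg_pos.2 (Real.log_neg hq0 hq1)
  set c := -Real.log q with hcdef
  have hs' : (0 : ℝ) < s := by exact_mod_cast hs
  have htend : Tendsto (fun n : ℕ => Real.log n) atTop atTop :=
    Real.tendsto_log_atTop.comp tendsto_natCast_atTop_atTop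
  filter_upwards [htend.eventually_ge_atTop 1, htend.eventually_ge_atTop (s * (2 + c) / c),
    eventually_ge_atTop 1] with n h1 h2 hn
  have hn0 : (0 : ℝ) < n := by exact_mod_cast hn
  set u := Real.log n with hu
  set j := ⌈u ^ 2⌉₊ / s with hj
  have hj1 : u ^ 2 ≤ (j + 1) * s := by
    refine (Nat.le_ceil _).trans ?_
    exact_mod_cast (Nat.lt_mul_of_div_lt (Nat.lt_succ_self _) hs).le
  have hj2 : 2 * u ≤ j * c := by
    rw [div_le_iff₀ hc] at h2
    have h3 := mul_le_mul_of_nonneg_right h2 (by linarith : 0 ≤ u)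
    have h4 := mul_le_mul_of_nonneg_right hj1 hc.le
    have h5 : s * ((2 + c) * u) ≤ s * ((j + 1) * c) := by nlinarith
    have h6 := le_of_mul_le_mul_left h5 hs'
    nlinarith
  calc r ^ j * n ≤ q ^ j * n := by gcongr; exact le_max_left _ _
    _ = Real.exp (u - j * c) := by
        rw [sub_eq_add_neg, Real.exp_add, hu, Real.exp_log hn0, hcdef, ← mul_neg, neg_neg,
          Real.exp_nat_mul, Real.exp_log hq0, mul_comm]
    _ ≤ Real.exp (u * (-(1 / 6))) := Real.exp_le_exp.2 (by linarith)
    _ = (n : ℝ) ^ (-(1 / 6) : ℝ) := by rw [Real.rpow_def_of_pos hn0]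

lemma eventually_mul_div_le {δ : ℝ} (hδ : 0 < δ) :
    ∀ᶠ n : ℕ in atTop, ∀ m k : ℕ, m ≤ ⌈Real.log n ^ 2⌉₊ → (k : ℝ) ≤ (n : ℝ) ^ ((1 : ℝ) / 3) →
      (m * (2 * m + 2 * k + 2) : ℝ) / (δ * n) ^ 2 ≤ (n : ℝ) ^ (-(1 / 6) : ℝ) / n := by
  have hlog : ∀ᶠ n : ℕ in atTop, ‖Real.log n‖ ≤ 1 * ‖(n : ℝ) ^ ((1 : ℝ) / 24)‖ :=
    tendsto_natCast_atTop_atTop.eventually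
      ((isLittleO_log_rpow_atTop (by norm_num : (0 : ℝ) < 1 / 24)).bound one_pos)
  have htend : Tendsto (fun n : ℕ => (n : ℝ) ^ ((1 : ℝ) / 12)) atTop atTop :=
    (tendsto_rpow_atTop (by norm_num)).comp tendsto_natCast_atTop_atTop
  filter_upwards [hlog, htend.eventually_ge_atTop 1, htend.eventually_ge_atTop (16 / δ ^ 2),
    eventually_ge_atTop 1] with n hlog h1 h2 hn m k hm hk
  have hn0 : (0 : ℝ) < n := by exact_mod_cast hn
  set a := (n : ℝ) ^ ((1 : ℝ) / 12) with ha
  have ha0 : 0 < a := by positivity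
  have ha4 : (n : ℝ) ^ ((1 : ℝ) / 3) = a ^ 4 := by
    rw [ha, ← Real.rpow_natCast, ← Real.rpow_mul hn0.le]; norm_num
  have ha12 : (n : ℝ) = a ^ 12 := by
    rw [ha, ← Real.rpow_natCast, ← Real.rpow_mul hn0.le]; norm_num
  have ha2 : (n : ℝ) ^ (-(1 / 6) : ℝ) * a ^ 2 = 1 := by
    rw [ha, ← Real.rpow_natCast, ← Real.rpow_mul hn0.le, ← Real.rpow_add hn0]; norm_num
  have hlog2 : Real.log n ^ 2 ≤ a := by
    have h24 : a = ((n : ℝ) ^ ((1 : ℝ) / 24)) ^ 2 := by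
      rw [ha, ← Real.rpow_natCast, ← Real.rpow_mul hn0.le]; norm_num
    rw [h24, ← sq_abs (Real.log n)]
    rw [one_mul, Real.norm_eq_abs, Real.norm_of_nonneg (by positivity)] at hlog
    gcongr
  have hm2 : (m : ℝ) ≤ 2 * a := by
    have h := (Nat.ceil_lt_add_one (sq_nonneg (Real.log n))).le
    have hm' : (m : ℝ) ≤ ⌈Real.log n ^ 2⌉₊ := by exact_mod_cast hm
    linarith
  rw [ha4] at hk
  have h14 : 1 ≤ a ^ 4 := one_le_pow₀ h1
  have ha14 : a ≤ a ^ 4 := by simpa using pow_le_pow_right₀ h1 (show 1 ≤ 4 by norm_num)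
  have ha15 : a ≤ a ^ 5 := by simpa using pow_le_pow_right₀ h1 (show 1 ≤ 5 by norm_num)
  have hnum : (m * (2 * m + 2 * k + 2) : ℝ) ≤ 16 * a ^ 5 := by
    calc (m * (2 * m + 2 * k + 2) : ℝ) ≤ 2 * a * (8 * a ^ 4) := by gcongr; linarith
      _ = 16 * a ^ 5 := by ring
  rw [div_le_iff₀ (by positivity)] at h2
  have ha2' : (n : ℝ) ^ (-(1 / 6) : ℝ) = 1 / a ^ 2 := by
    rw [eq_div_iff (by positivity), ha2]
  rw [ha2', ha12, div_div, div_le_div_iff₀ (by positivity) (by positivity)]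
  calc (m * (2 * m + 2 * k + 2) : ℝ) * (a ^ 2 * a ^ 12) ≤ 16 * a ^ 5 * (a ^ 2 * a ^ 12) := by gcongr
    _ ≤ (a ^ 5 * δ ^ 2) * a ^ 5 * (a ^ 2 * a ^ 12) := by
        gcongr
        exact h2.trans (by gcongr)
    _ = 1 * (δ * a ^ 12) ^ 2 := by ring

end Asymptotics

/-- switching degrees, lower class. -/
theorem switching_degree_lower_class :
    ∀ δ : ℝ, 0 < δ → δ ≤ 1 →
    ∃ τ₀ : ℝ, 0 < τ₀ ∧
    ∀ τ ν : ℝ, 0 < ν → ν ≤ τ → τ ≤ τ₀ →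
    ∃ n₀ : ℕ, ∀ n : ℕ, n₀ ≤ n → Even n →
    ∀ ℓ : ℕ, ℓ = ⌈(Real.log n) ^ 2⌉₊ + 1 →
    ∀ (V : Type) [Fintype V] [DecidableEq V], Fintype.card V = n →
    ∀ G : SimpleGraph V,
      (∀ v : V, (Nat.card {u : V | G.Adj v u} : ℝ) = δ * (n : ℝ)) →
      RobustExpander G ν τ →
    ∀ N : Finset (Sym2 V), IsMatchingIn G N →
    ∀ k : ℕ, 1 ≤ k →
      (k : ℝ) ≤ min (N.card : ℝ) ((n : ℝ) ^ ((1 : ℝ) / 3)) →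
    ∀ M' : Finset (Sym2 V), IsPM G M' → (M' ∩ N).card = k - 1 →
      (1 - 3 * (n : ℝ) ^ (-(1 / 6) : ℝ)) * δ ^ (ℓ - 1) * (n : ℝ) ^ (ℓ - 2) *
          ((N.card : ℝ) - (k : ℝ) + 1) ≤
        (Nat.card {M : Finset (Sym2 V) // IsPM G M ∧ (M ∩ N).card = k ∧
          IsCycleEdgeSet (symmDiff M M') (2 * ℓ) ∧ ((symmDiff M M') ∩ N).card = 1} : ℝ) ∧
      (Nat.card {M : Finset (Sym2 V) // IsPM G M ∧ (M ∩ N).card = k ∧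
          IsCycleEdgeSet (symmDiff M M') (2 * ℓ) ∧ ((symmDiff M M') ∩ N).card = 1} : ℝ) ≤
        (1 + 3 * (n : ℝ) ^ (-(1 / 6) : ℝ)) * δ ^ (ℓ - 1) * (n : ℝ) ^ (ℓ - 2) *
          ((N.card : ℝ) - (k : ℝ) + 1) := by
  intro δ hδ0 hδ1
  refine ⟨δ / 2, by linarith, fun τ ν hν hντ hτ => ?_⟩
  obtain ⟨t, ht⟩ := exists_nat_ge (1 / ν)
  have htν : 1 ≤ t * ν := (div_le_iff₀ hν).1 ht
  have hν1 : ν ^ t ≤ 1 := pow_le_one₀ hν.le (by linarith)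
  have hνt : 0 < ν ^ t := pow_pos hν t
  have hlog : ∀ᶠ n : ℕ in Filter.atTop, 1 < Real.log n :=
    (Real.tendsto_log_atTop.comp tendsto_natCast_atTop_atTop).eventually_gt_atTop 1
  obtain ⟨n₀, hn₀⟩ := Filter.eventually_atTop.1
    ((eventually_pow_div_mul_le (sub_nonneg.2 hν1) (by linarith : 1 - ν ^ t < 1)
      (Nat.succ_pos t)).and ((eventually_mul_div_le hδ0).and
      (hlog.and (Filter.eventually_ge_atTop 1))))
  refine ⟨n₀, fun n hn _ ℓ hℓ V _ _ hV G hdeg hG N hN k hk1 hk M' hpm hcard => ?_⟩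
  obtain ⟨hmix, havoid, hlogn, hn1⟩ := hn₀ n hn
  classical
  have hn0 : (0 : ℝ) < n := by exact_mod_cast hn1
  have hdeg' : ∀ v, (G.degree v : ℝ) = δ * n := fun v => by
    rw [← hdeg v, ← SimpleGraph.card_neighborSet_eq_degree, ← Nat.card_eq_fintype_card]
    rfl
  obtain ⟨v₀⟩ : Nonempty V := Fintype.card_pos_iff.1 (by omega)
  obtain ⟨d, hd₀⟩ : ∃ d, G.degree v₀ = d := ⟨_, rfl⟩
  have hdn : (d : ℝ) = δ * n := hd₀ ▸ hdeg' v₀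
  have hd : ∀ v, G.degree v = d := fun v => by
    have : (G.degree v : ℝ) = d := (hdeg' v).trans hdn.symm
    exact_mod_cast this
  have hd0 : 0 < d := by
    have : (0 : ℝ) < d := hdn ▸ mul_pos hδ0 hn0
    exact_mod_cast this
  obtain ⟨σ, hσ⟩ := hpm.exists_isMate
  have hceil : 1 < ⌈Real.log n ^ 2⌉₊ := Nat.lt_ceil.2 (by push_cast; nlinarith)
  obtain ⟨m, hm⟩ : ∃ m, ⌈Real.log n ^ 2⌉₊ = m + 1 := ⟨_, (Nat.succ_pred_eq_of_pos (by omega)).symm⟩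
  rw [hm] at hℓ hmix
  subst hℓ
  set ε := (n : ℝ) ^ (-(1 / 6) : ℝ) with hε
  have hε0 : 0 < ε := by positivity
  obtain ⟨hlow, hup⟩ := card_isSwitching_mem_interval (ε := ε) hd hd0 (by omega : 1 ≤ m) hk1 hN hpm
    hσ hcard (fun y z => by
      refine (abs_pow_walkMatrix_sub_le G σ hd hσ.involutive hν hντ ?_ hG htν _ y z).trans ?_
      · rw [hV, hdn]
        gcongr
        linarith
      · rw [hV, div_mul_eq_mul_div, le_div_iff₀ hn0, mul_assoc]
        gcongr) (by
      rw [hV, hdn]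
      exact havoid m k (by omega) (hk.trans (min_le_right _ _)))
  have hcount : (#(N \ M') : ℝ) = (#N : ℝ) - k + 1 := by
    have := card_sdiff_add_card_inter N M'
    rw [inter_comm, hcard] at this
    have h : ((#(N \ M') + (k - 1) : ℕ) : ℝ) = #N := by rw [this]
    push_cast [Nat.cast_sub hk1] at h
    linarith
  have hmain : (d : ℝ) ^ (m + 1) / Fintype.card V = δ ^ (m + 1) * (n : ℝ) ^ m := by
    rw [hV, hdn, mul_pow, pow_succ (n : ℝ)]
    field_simp
  rw [hcount, hmain] at hlow hup
  have hnonneg : 0 ≤ ((#N : ℝ) - k + 1) * (ε * (δ ^ (m + 1) * (n : ℝ) ^ m)) := by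
    rw [← hcount]
    positivity
  constructor
  · refine le_trans ?_ hlow
    simp only [Nat.add_sub_cancel, show m + 1 + 1 - 2 = m by omega]
    linarith
  · refine hup.trans ?_
    simp only [Nat.add_sub_cancel, show m + 1 + 1 - 2 = m by omega]
    linarith

end RPM
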